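/- For every constant C ≥ 1 and every ε > 0 there is N₀ ∈ ℕ such that for all N ≥ N₀ and all natural numbers k with |k − log log N| ≤ C√(log log N), one has | π_N(k)/N − g_N(k) | ≤ ε · g_N(k), where g_N(k) := (2π log log N)^{−1/2} · exp( −(k − log log N)² / (2 log log N) ). In other words, π_N(k)/N = g_N(k)(1 + o(1)) uniformly for k in the interval [log log N − C√(log log N), log log N + C√(log log N)]. -/

import Mathlib

open Filter Finset Real

/-- `Ω(n)`: the number of prime factors of `n` counted with multiplicity. -/
def bigOmega (n : ℕ) : ℕ := (Nat.primeFactorsList n).length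

/-- `π_N(k) = #{ n ≤ N : Ω(n) = k }`. -/
def piOmega (N k : ℕ) : ℕ :=
  ((Finset.Icc 1 N).filter (fun n => bigOmega n = k)).card

/-- The Gaussian density with mean and variance `log log N`. -/
noncomputable def gaussN (N k : ℕ) : ℝ :=
  (1 / Real.sqrt (2 * Real.pi * Real.log (Real.log N))) *
    Real.exp (-((k : ℝ) - Real.log (Real.log N)) ^ 2 / (2 * Real.log (Real.log N)))

open MeasureTheory Topology in
lemma integrable_sinc_half_sq : Integrable (fun x : ℝ => sinc (x / 2) ^ 2) := by
  have h := (integrable_inv_one_add_sq).const_mul 5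
  refine h.mono' (by fun_prop) (ae_of_all _ fun x => ?_)
  rw [Real.norm_of_nonneg (sq_nonneg _), ← div_eq_mul_inv, le_div_iff₀ (by positivity)]
  have h1 : sinc (x / 2) ^ 2 ≤ 1 := (sq_le_one_iff_abs_le_one _).2 (abs_sinc_le_one _)
  have h2 : sinc (x / 2) ^ 2 * x ^ 2 ≤ 4 := by
    rcases eq_or_ne x 0 with rfl | hx
    · simp
    · rw [sinc_of_ne_zero (by simpa using hx)]
      have := sin_sq_le_one (x / 2)
      field_simp
      linarith
  nlinarith

open MeasureTheory Topology in
lemma integral_sinc_half_sq_pos : 0 < ∫ x : ℝ, sinc (x / 2) ^ 2 := by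
  refine integral_pos_of_integrable_nonneg_nonzero (x := 0) ?_ integrable_sinc_half_sq
    (fun x => sq_nonneg _) (by simp)
  exact (continuous_sinc.comp (continuous_id.div_const 2)).pow 2

/-- The Fourier transform of the tent function is the Fejér kernel. -/
lemma integral_tent_mul_exp (x : ℝ) :
    ∫ y : ℝ, ((max (1 - |y|) 0 : ℝ) : ℂ) * Complex.exp (Complex.I * (y * x)) =
      ((sinc (x / 2) ^ 2 : ℝ) : ℂ) := by
  set c : ℂ := Complex.I * x with hc
  have h0 : ∫ y : ℝ, ((max (1 - |y|) 0 : ℝ) : ℂ) * Complex.exp (Complex.I * (y * x)) =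
      ∫ y in (-1 : ℝ)..1, ((max (1 - |y|) 0 : ℝ) : ℂ) * Complex.exp (c * y) := by
    rw [intervalIntegral.integral_eq_integral_of_support_subset]
    · congr 1; ext y; rw [hc]; ring_nf
    · intro y hy
      rw [Function.mem_support] at hy
      have : 0 < 1 - |y| := by
        by_contra! h
        simp [max_eq_right h] at hy
      have := abs_lt.1 (show |y| < 1 by linarith)
      exact ⟨this.1, this.2.le⟩
  have hcont : Continuous fun y : ℝ => ((max (1 - |y|) 0 : ℝ) : ℂ) * Complex.exp (c * y) := by
    fun_prop
  rw [h0, ← intervalIntegral.integral_add_adjacent_intervals (b := 0)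
    (hcont.intervalIntegrable _ _) (hcont.intervalIntegrable _ _)]
  have h1 : ∫ y in (-1 : ℝ)..0, ((max (1 - |y|) 0 : ℝ) : ℂ) * Complex.exp (c * y) =
      ∫ y in (-1 : ℝ)..0, (1 + y : ℂ) * Complex.exp (c * y) := by
    refine intervalIntegral.integral_congr fun y hy => ?_
    rw [Set.uIcc_of_le (by norm_num)] at hy
    rw [abs_of_nonpos hy.2, max_eq_left (by linarith [hy.1])]
    push_cast; ring
  have h2 : ∫ y in (0 : ℝ)..1, ((max (1 - |y|) 0 : ℝ) : ℂ) * Complex.exp (c * y) =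
      ∫ y in (0 : ℝ)..1, (1 - y : ℂ) * Complex.exp (c * y) := by
    refine intervalIntegral.integral_congr fun y hy => ?_
    rw [Set.uIcc_of_le (by norm_num)] at hy
    rw [abs_of_nonneg hy.1, max_eq_left (by linarith [hy.2])]
    push_cast; ring
  rw [h1, h2]
  rcases eq_or_ne x 0 with rfl | hx
  · have hc0 : c = 0 := by simp [hc]
    simp only [hc0, zero_mul, Complex.exp_zero, mul_one, zero_div, sinc_zero, one_pow,
      Complex.ofReal_one]
    have e1 : ∫ y in (-1 : ℝ)..0, (1 + y : ℂ) = ((∫ y in (-1 : ℝ)..0, (1 + y) : ℝ) : ℂ) := by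
      rw [← intervalIntegral.integral_ofReal]; push_cast; rfl
    have e2 : ∫ y in (0 : ℝ)..1, (1 - y : ℂ) = ((∫ y in (0 : ℝ)..1, (1 - y) : ℝ) : ℂ) := by
      rw [← intervalIntegral.integral_ofReal]; push_cast; rfl
    rw [e1, e2, intervalIntegral.integral_add (by simp) (by simp),
      intervalIntegral.integral_sub (by simp) (by simp)]
    simp only [intervalIntegral.integral_const, integral_id]
    norm_num
  have hc0 : c ≠ 0 := by simp [hc, hx]
  have hexp (y : ℝ) : HasDerivAt (fun y : ℝ => Complex.exp (c * y)) (Complex.exp (c * y) * c) y := by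
    have := ((hasDerivAt_id (y : ℂ)).const_mul c).cexp.comp_ofReal
    simpa using this
  have hid (y : ℝ) : HasDerivAt (fun y : ℝ => (y : ℂ)) 1 y := (hasDerivAt_id (y : ℂ)).comp_ofReal
  have F1 : ∫ y in (-1 : ℝ)..0, (1 + y : ℂ) * Complex.exp (c * y) =
      1 / c - 1 / c ^ 2 + Complex.exp (-c) / c ^ 2 := by
    rw [intervalIntegral.integral_eq_sub_of_hasDerivAt
      (f := fun y : ℝ => (1 + y : ℂ) * Complex.exp (c * y) / c - Complex.exp (c * y) / c ^ 2)]
    · simp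
    · intro y _
      convert! ((((hid y).const_add 1).mul (hexp y)).div_const c).sub ((hexp y).div_const (c ^ 2))
        using 1
      field_simp; ring
    · exact (by fun_prop : Continuous fun y : ℝ => (1 + y : ℂ) * Complex.exp (c * y)).intervalIntegrable
        _ _
  have F2 : ∫ y in (0 : ℝ)..1, (1 - y : ℂ) * Complex.exp (c * y) =
      Complex.exp c / c ^ 2 - 1 / c - 1 / c ^ 2 := by
    rw [intervalIntegral.integral_eq_sub_of_hasDerivAt
      (f := fun y : ℝ => (1 - y : ℂ) * Complex.exp (c * y) / c + Complex.exp (c * y) / c ^ 2)]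
    · simp; ring
    · intro y _
      convert! ((((hid y).const_sub 1).mul (hexp y)).div_const c).add ((hexp y).div_const (c ^ 2))
        using 1
      field_simp; ring
    · exact (by fun_prop : Continuous fun y : ℝ => (1 - y : ℂ) * Complex.exp (c * y)).intervalIntegrable
        _ _
  rw [F1, F2, sinc_of_ne_zero (by simpa using hx)]
  have h3 : Complex.exp c + Complex.exp (-c) = 2 - 4 * (Complex.sin (x / 2)) ^ 2 := by
    have : Complex.exp c + Complex.exp (-c) = 2 * Complex.cos x := by
      rw [Complex.cos, hc]; ring_nf
    rw [this, show (x : ℂ) = 2 * (x / 2) by ring, Complex.cos_two_mul, Complex.cos_sq']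
    ring_nf
  have hc2 : c ^ 2 = -(x : ℂ) ^ 2 := by rw [hc, mul_pow, Complex.I_sq]; ring
  have hx' : (x : ℂ) ≠ 0 := by exact_mod_cast hx
  calc _ = (Complex.exp c + Complex.exp (-c) - 2) / c ^ 2 := by ring
    _ = _ := by
      rw [h3, hc2]; push_cast; field_simp; ring

open MeasureTheory Topology in
/-- If the Laplace transform of a bounded function supported on `[0, ∞)` extends continuously to the
closed right half plane, then its Fejér means tend to zero at infinity. -/
lemma tendsto_fejer_mean_zero {g : ℝ → ℝ} (hg : Measurable g) {K : ℝ} (hK : ∀ u, |g u| ≤ K)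
    (hg0 : ∀ u ≤ 0, g u = 0) {G : ℂ → ℂ} (hG : ContinuousOn G {s | 0 ≤ s.re})
    (hgG : ∀ s : ℂ, 0 < s.re → ∫ u, (g u : ℂ) * Complex.exp (-(s * u)) = G s)
    {R : ℝ} (hR : 0 < R) :
    Tendsto (fun v => ∫ x, g (v - x / R) * sinc (x / 2) ^ 2) atTop (𝓝 0) := by
  set w : ℝ → ℂ := fun y => ((max (1 - |y|) 0 : ℝ) : ℂ) with hw
  have hwc : Continuous w := by fun_prop
  have hwsupp : ∀ y, y ∉ Set.Icc (-1 : ℝ) 1 → w y = 0 := by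
    intro y hy
    have : 1 - |y| ≤ 0 := by
      by_contra! h
      exact hy ⟨(abs_lt.1 (show |y| < 1 by linarith)).1.le, (abs_lt.1 (show |y| < 1 by linarith)).2.le⟩
    simp [hw, max_eq_right this]
  have hwint : Integrable w :=
    hwc.integrable_of_hasCompactSupport (HasCompactSupport.intro isCompact_Icc hwsupp)
  have hK0 : 0 ≤ K := (abs_nonneg _).trans (hK 0)
  have hgexp (δ : ℝ) (hδ : 0 < δ) : Integrable fun u => (g u : ℂ) * Complex.exp (-(δ * u)) := by
    have h1 : IntegrableOn (fun u => K * Real.exp (-δ * u)) (Set.Ioi 0) :=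
      (integrableOn_exp_mul_Ioi (by linarith) 0).const_mul K
    rw [← integrable_indicator_iff measurableSet_Ioi] at h1
    refine h1.mono' (by fun_prop) (ae_of_all _ fun u => ?_)
    rcases le_or_gt u 0 with hu | hu
    · simp [hg0 u hu, hu.not_gt]
    · rw [Set.indicator_of_mem (by exact hu), norm_mul, Complex.norm_exp, Complex.norm_real]
      simp only [Complex.neg_re, Complex.re_ofReal_mul, Complex.ofReal_re, norm_eq_abs]
      rw [neg_mul]
      gcongr
      exact hK u
  -- the smoothed identity for positive `δ`
  have key (v δ : ℝ) (hδ : 0 < δ) :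
      ∫ y, w y * Complex.exp (Complex.I * (y * (R * v))) * G (δ + Complex.I * (y * R)) =
      ∫ u, (g u : ℂ) * Complex.exp (-(δ * u)) * ((sinc (R * (v - u) / 2) ^ 2 : ℝ) : ℂ) := by
    have e1 (y : ℝ) : w y * Complex.exp (Complex.I * (y * (R * v))) * G (δ + Complex.I * (y * R)) =
        ∫ u : ℝ, Complex.exp (Complex.I * (y * (R * (v - u)))) *
          (w y * ((g u : ℂ) * Complex.exp (-(δ * u)))) := by
      rw [← hgG _ (by simpa using hδ), ← integral_const_mul]
      congr 1; ext u
      have : Complex.exp (-((δ + Complex.I * (y * R)) * u)) =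
          Complex.exp (-(δ * u)) * Complex.exp (-(Complex.I * (y * (R * u)))) := by
        rw [← Complex.exp_add]; ring_nf
      rw [this, show Complex.I * (y * (R * (v - u : ℂ))) =
        Complex.I * (y * (R * v)) + -(Complex.I * (y * (R * u))) by ring, Complex.exp_add]
      ring
    simp_rw [e1]
    rw [integral_integral_swap]
    · congr 1; ext u
      rw [← integral_tent_mul_exp, ← integral_const_mul]
      congr 1; ext y
      push_cast
      simp only [hw]
      ring
    · have := hwint.mul_prod (hgexp δ hδ)
      refine this.bdd_mul (c := 1) ?_ (ae_of_all _ fun z => ?_)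
      · exact (by fun_prop : Continuous fun z : ℝ × ℝ =>
          Complex.exp (Complex.I * (z.1 * (R * (v - z.2))))).aestronglyMeasurable
      · rw [Complex.norm_exp]; simp
  have key0 (v : ℝ) :
      ∫ y, w y * Complex.exp (Complex.I * (y * (R * v))) * G (Complex.I * (y * R)) =
      ∫ u, (g u : ℂ) * ((sinc (R * (v - u) / 2) ^ 2 : ℝ) : ℂ) := by
    have hk : Integrable fun u => sinc (R * (v - u) / 2) ^ 2 := by
      have := (integrable_sinc_half_sq.comp_mul_left' hR.ne').comp_sub_left v
      exact this
    obtain ⟨M, hM⟩ : ∃ M, ∀ δ ∈ Set.Icc (0:ℝ) 1, ∀ y ∈ Set.Icc (-1:ℝ) 1,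
        ‖G (δ + Complex.I * (y * R))‖ ≤ M := by
      have hcomp : IsCompact ((fun p : ℝ × ℝ => (p.1 + Complex.I * (p.2 * R) : ℂ)) ''
          (Set.Icc 0 1 ×ˢ Set.Icc (-1) 1)) :=
        (isCompact_Icc.prod isCompact_Icc).image (by fun_prop)
      obtain ⟨M, hM⟩ := hcomp.exists_bound_of_continuousOn (hG.mono (by
        rintro _ ⟨p, hp, rfl⟩
        simpa using hp.1.1))
      exact ⟨M, fun δ hδ y hy => hM _ ⟨(δ, y), ⟨hδ, hy⟩, rfl⟩⟩
    have hcG (δ : ℝ) (hδ : 0 ≤ δ) : Continuous fun y : ℝ => G (δ + Complex.I * (y * R)) := by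
      refine hG.comp_continuous (by fun_prop) fun y => by simpa using hδ
    have l1 : Tendsto (fun δ : ℝ => ∫ y, w y * Complex.exp (Complex.I * (y * (R * v))) *
        G (δ + Complex.I * (y * R))) (𝓝[>] 0)
        (𝓝 (∫ y, w y * Complex.exp (Complex.I * (y * (R * v))) * G (Complex.I * (y * R)))) := by
      refine tendsto_integral_filter_of_dominated_convergence (fun y => ‖w y‖ * M) ?_ ?_ ?_ ?_
      · filter_upwards [self_mem_nhdsWithin] with δ hδ
        have := hcG δ (le_of_lt hδ)
        exact ((hwc.mul (by fun_prop)).mul this).aestronglyMeasurable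
      · filter_upwards [Ioc_mem_nhdsGT (show (0:ℝ) < 1 by norm_num)] with δ hδ
        refine ae_of_all _ fun y => ?_
        by_cases hy : y ∈ Set.Icc (-1 : ℝ) 1
        · rw [norm_mul, norm_mul, Complex.norm_exp]
          simp only [Complex.mul_re, Complex.I_re, Complex.I_im, Complex.ofReal_im, Complex.mul_im,
            Complex.ofReal_re]
          simp only [mul_zero, zero_mul, add_zero, sub_zero, Real.exp_zero, mul_one]
          gcongr
          exact hM δ ⟨hδ.1.le, hδ.2⟩ y hy
        · simp [hwsupp y hy]
      · exact hwint.norm.mul_const M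
      · refine ae_of_all _ fun y => ?_
        refine Tendsto.const_mul _ ?_
        have hc : ContinuousOn (fun δ : ℝ => G (δ + Complex.I * (y * R))) (Set.Ici 0) := by
          refine hG.comp (by fun_prop) fun δ hδ => by simpa using hδ
        have := (hc 0 (by simp)).mono (Set.Ioi_subset_Ici le_rfl)
        simpa [ContinuousWithinAt] using this
    have l2 : Tendsto (fun δ : ℝ => ∫ u, (g u : ℂ) * Complex.exp (-(δ * u)) *
        ((sinc (R * (v - u) / 2) ^ 2 : ℝ) : ℂ)) (𝓝[>] 0)
        (𝓝 (∫ u, (g u : ℂ) * ((sinc (R * (v - u) / 2) ^ 2 : ℝ) : ℂ))) := by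
      refine tendsto_integral_filter_of_dominated_convergence
        (fun u => K * sinc (R * (v - u) / 2) ^ 2) ?_ ?_ ?_ ?_
      · exact Eventually.of_forall fun δ => by fun_prop
      · filter_upwards [self_mem_nhdsWithin] with δ hδ
        refine ae_of_all _ fun u => ?_
        rw [norm_mul, Complex.norm_real, Real.norm_of_nonneg (sq_nonneg _)]
        refine mul_le_mul_of_nonneg_right ?_ (sq_nonneg _)
        rcases le_or_gt u 0 with hu | hu
        · simpa [hg0 u hu] using hK0
        · rw [norm_mul, Complex.norm_exp, Complex.norm_real]
          have : Real.exp ((-(δ * u) : ℂ)).re ≤ 1 := by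
            rw [Real.exp_le_one_iff]
            have : 0 ≤ δ * u := mul_nonneg (le_of_lt hδ) hu.le
            simpa using this
          calc _ ≤ K * 1 := by
                gcongr
                exact hK u
            _ = K := mul_one K
      · exact hk.const_mul K
      · refine ae_of_all _ fun u => ?_
        refine Tendsto.mul_const _ ?_
        have : Continuous fun δ : ℝ => (g u : ℂ) * Complex.exp (-(δ * u)) := by fun_prop
        have := (this.tendsto 0).mono_left (nhdsWithin_le_nhds (s := Set.Ioi 0))
        simpa using this
    refine tendsto_nhds_unique l1 (l2.congr' ?_)
    filter_upwards [self_mem_nhdsWithin] with δ hδ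
    exact (key v δ hδ).symm
  have hRL := Real.tendsto_integral_exp_smul_cocompact (fun y : ℝ => w y * G (Complex.I * (y * R)))
  have hlim : Tendsto (fun v : ℝ => -(R * v / (2 * π))) atTop (cocompact ℝ) := by
    refine Tendsto.mono_right ?_ atBot_le_cocompact
    refine tendsto_neg_atTop_atBot.comp ?_
    exact (tendsto_id.const_mul_atTop hR).atTop_div_const (by positivity)
  have hRL2 := (hRL.comp hlim).const_mul (R : ℂ)
  rw [mul_zero] at hRL2
  have hre := (Complex.continuous_re.tendsto 0).comp hRL2
  rw [Complex.zero_re] at hre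
  refine hre.congr fun v => ?_
  simp only [Function.comp]
  have e2 : ∫ y, Real.fourierChar (-(y * -(R * v / (2 * π)))) • (w y * G (Complex.I * (y * R))) =
      ∫ u, (g u : ℂ) * ((sinc (R * (v - u) / 2) ^ 2 : ℝ) : ℂ) := by
    rw [← key0 v]
    congr 1; ext y
    rw [Circle.smul_def, Real.fourierChar_apply, smul_eq_mul]
    have : ((2 * π * -(y * -(R * v / (2 * π))) : ℝ) : ℂ) * Complex.I =
        Complex.I * (y * (R * v)) := by
      have hpi : (π : ℂ) ≠ 0 := by exact_mod_cast pi_ne_zero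
      push_cast
      field_simp
    rw [this]; ring
  rw [e2]
  have e3 : ∫ u, (g u : ℂ) * ((sinc (R * (v - u) / 2) ^ 2 : ℝ) : ℂ) =
      ((∫ u, g u * sinc (R * (v - u) / 2) ^ 2 : ℝ) : ℂ) := by
    rw [← integral_complex_ofReal]; push_cast; rfl
  rw [e3, ← Complex.ofReal_mul, Complex.ofReal_re]
  rw [← integral_sub_left_eq_self _ volume v]
  have := Measure.integral_comp_mul_left (fun x => g (v - x / R) * sinc (x / 2) ^ 2) R
  rw [smul_eq_mul, abs_of_pos (inv_pos.2 hR)] at this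
  rw [eq_comm, ← inv_mul_eq_iff_eq_mul₀ hR.ne', ← this]
  congr 1; ext x
  rw [mul_div_cancel_left₀ _ hR.ne', sub_sub_cancel]

open MeasureTheory Topology in
/-- A bounded function whose Fejér means tend to zero cannot be bounded away from zero, with a
constant sign, on arbitrarily far intervals of a fixed length. -/
lemma eventually_exists_lt_of_fejer_mean_zero {g : ℝ → ℝ} (hg : Measurable g) {K : ℝ}
    (hK : ∀ u, |g u| ≤ K)
    (hlim : ∀ R : ℝ, 0 < R → Tendsto (fun v => ∫ x, g (v - x / R) * sinc (x / 2) ^ 2) atTop (𝓝 0))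
    {η h : ℝ} (hη : 0 < η) (hh : 0 < h) :
    ∀ᶠ v in atTop, ∃ u, |v - u| ≤ h ∧ g u < η := by
  set k : ℝ → ℝ := fun x => sinc (x / 2) ^ 2 with hk
  have hkint : Integrable k := integrable_sinc_half_sq
  have hk0 : ∀ x, 0 ≤ k x := fun x => sq_nonneg _
  have hK0 : 0 ≤ K := (abs_nonneg _).trans (hK 0)
  set I := ∫ x, k x with hI
  have hIpos : 0 < I := integral_sinc_half_sq_pos
  obtain ⟨A, hA0, hA⟩ : ∃ A : ℝ, 0 < A ∧ (K + η) * ∫ x in {x | A < |x|}, k x < η * I / 2 := by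
    have hanti : Tendsto (fun A : ℝ => ∫ x in {x : ℝ | A < |x|}, k x) atTop
        (𝓝 (∫ x in ⋂ A : ℝ, {x : ℝ | A < |x|}, k x)) := by
      refine tendsto_setIntegral_of_antitone (fun A => ?_) (fun A B hAB x hx => ?_)
        ⟨0, hkint.integrableOn⟩
      · exact (isOpen_lt continuous_const continuous_abs).measurableSet
      · exact lt_of_le_of_lt hAB hx
    have hemp : (⋂ A : ℝ, {x : ℝ | A < |x|}) = ∅ := by
      ext x; simp only [Set.mem_iInter, Set.mem_ofPred_eq, Set.mem_empty_iff_false, iff_false]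
      intro hx; exact lt_irrefl _ (hx |x|)
    rw [hemp, setIntegral_empty] at hanti
    have := hanti.const_mul (K + η)
    rw [mul_zero] at this
    obtain ⟨A, hA⟩ := ((eventually_gt_atTop 0).and
      (this.eventually (gt_mem_nhds (show 0 < η * I / 2 by positivity)))).exists
    exact ⟨A, hA⟩
  have hev := (hlim (A / h) (by positivity)).eventually
    (gt_mem_nhds (show 0 < η * I / 2 by positivity))
  filter_upwards [hev] with v hv
  by_contra! hcon
  have hgint : Integrable fun x => g (v - x / (A / h)) * k x := by
    refine hkint.bdd_mul (c := K) ?_ (ae_of_all _ fun x => hK _)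
    exact (hg.comp (by fun_prop)).aestronglyMeasurable
  have hms : MeasurableSet {x : ℝ | A < |x|} :=
    (isOpen_lt continuous_const continuous_abs).measurableSet
  have hle : ∫ x, (η * k x - (K + η) * Set.indicator {x : ℝ | A < |x|} k x) ≤
      ∫ x, g (v - x / (A / h)) * k x := by
    refine integral_mono ((hkint.const_mul _).sub ((hkint.indicator hms).const_mul _)) hgint
      fun x => ?_
    simp only
    by_cases hx : A < |x|
    · rw [Set.indicator_of_mem (by exact hx)]
      have := (abs_le.1 (hK (v - x / (A / h)))).1
      nlinarith [hk0 x]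
    · rw [Set.indicator_of_notMem (by exact hx), mul_zero, sub_zero]
      refine mul_le_mul_of_nonneg_right (hcon _ ?_) (hk0 x)
      rw [sub_sub_cancel, abs_div, abs_of_pos (div_pos hA0 hh), div_le_iff₀ (by positivity)]
      rw [mul_div_cancel₀ _ hh.ne']
      exact not_lt.1 hx
  rw [integral_sub (hkint.const_mul _) ((hkint.indicator hms).const_mul _), integral_const_mul,
    integral_const_mul, integral_indicator hms] at hle
  linarith

open MeasureTheory Topology in
/-- A Tauberian theorem: a bounded, slowly decreasing function whose Laplace transform extends
continuously to the closed half plane tends to zero. -/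
lemma tendsto_zero_of_laplace_extends {g : ℝ → ℝ} (hg : Measurable g) {K : ℝ}
    (hK : ∀ u, |g u| ≤ K)
    (hg0 : ∀ u ≤ 0, g u = 0) {G : ℂ → ℂ} (hG : ContinuousOn G {s | 0 ≤ s.re})
    (hgG : ∀ s : ℂ, 0 < s.re → ∫ u, (g u : ℂ) * Complex.exp (-(s * u)) = G s)
    (hmono : ∀ u v, 0 < u → u ≤ v → (g u + 1) * exp u ≤ (g v + 1) * exp v)
    (hnn : ∀ u, 0 ≤ g u + 1) :
    Tendsto g atTop (𝓝 0) := by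
  have hlim := fun R hR => tendsto_fejer_mean_zero hg hK hg0 hG hgG (R := R) hR
  have hlim' : ∀ R : ℝ, 0 < R →
      Tendsto (fun v => ∫ x, (-g (v - x / R)) * sinc (x / 2) ^ 2) atTop (𝓝 0) := by
    intro R hR
    have := (hlim R hR).neg
    simp only [neg_zero, ← integral_neg] at this
    simpa only [neg_mul] using this
  rw [Metric.tendsto_atTop']
  intro ε hε
  wlog hε1 : ε ≤ 1 generalizing ε
  · obtain ⟨N, hN⟩ := this 1 one_pos le_rfl
    exact ⟨N, fun n hn => (hN n hn).trans (not_le.1 hε1)⟩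
  have hh : 0 < ε / 8 := by positivity
  have h1 := eventually_exists_lt_of_fejer_mean_zero hg hK hlim (half_pos hε) hh
  have h2 := eventually_exists_lt_of_fejer_mean_zero hg.neg (K := K) (by simpa using hK) hlim'
    (half_pos hε) hh
  have h1' := (tendsto_atTop_add_const_right atTop (ε / 8) tendsto_id).eventually h1
  have h2' := (tendsto_atTop_add_const_right atTop (-(ε / 8)) tendsto_id).eventually h2
  obtain ⟨N, hN⟩ := eventually_atTop.1 ((h1'.and h2').and (eventually_gt_atTop 1))
  refine ⟨N, fun v hv => ?_⟩
  obtain ⟨⟨⟨u, hu, hgu⟩, ⟨t, ht, hgt⟩⟩, hv1⟩ := hN v (le_of_lt hv)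
  rw [dist_zero_right, norm_eq_abs, abs_lt]
  simp only [id, Pi.neg_apply] at hu ht hgt
  rw [abs_le] at hu ht
  have hexp : exp (-(ε / 4)) ≥ 1 - ε / 4 := by linarith [add_one_le_exp (-(ε / 4))]
  constructor
  · have := hmono t v (by linarith) (by linarith)
    have h3 : (g t + 1) * exp (t - v) ≤ g v + 1 := by
      rw [exp_sub, ← mul_div_assoc, div_le_iff₀ (exp_pos _)]; exact this
    have h4 : exp (-(ε / 4)) ≤ exp (t - v) := exp_le_exp.2 (by linarith)
    nlinarith [hnn t]
  · have := hmono v u (by linarith) (by linarith)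
    have h3 : (g v + 1) * exp (v - u) ≤ g u + 1 := by
      rw [exp_sub, ← mul_div_assoc, div_le_iff₀ (exp_pos _)]; exact this
    have h4 : exp (-(ε / 4)) ≤ exp (v - u) := exp_le_exp.2 (by linarith)
    by_contra! hc
    nlinarith [hnn v]

open MeasureTheory Topology in
lemma LSeries_vonMangoldt_eq_mul_integral {s : ℂ} (hs : 1 < s.re) :
    LSeries (fun n => (ArithmeticFunction.vonMangoldt n : ℂ)) s =
      s * ∫ u in Set.Ioi (0 : ℝ),
        ((Chebyshev.psi (exp u) * exp (-u) : ℝ) : ℂ) * Complex.exp (-((s - 1) * u)) := by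
  rw [LSeries_eq_mul_integral_of_nonneg (r := 1) _ zero_le_one hs ?_
    (fun n => ArithmeticFunction.vonMangoldt_nonneg)]
  · congr 1
    have himg : Real.exp '' Set.Ioi 0 = Set.Ioi 1 := by
      ext t; constructor
      · rintro ⟨u, hu, rfl⟩; simpa using hu
      · intro ht
        exact ⟨log t, log_pos ht, exp_log (by linarith [Set.mem_Ioi.1 ht])⟩
    rw [← himg, integral_image_eq_integral_abs_deriv_smul measurableSet_Ioi
      (fun x _ => (Real.hasDerivAt_exp x).hasDerivWithinAt) (Real.exp_injective.injOn)]
    refine setIntegral_congr_fun measurableSet_Ioi fun u _ => ?_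
    have h1 : ((∑ k ∈ Icc 1 ⌊rexp u⌋₊, (ArithmeticFunction.vonMangoldt k : ℂ))) =
        ((Chebyshev.psi (exp u) : ℝ) : ℂ) := by
      rw [Chebyshev.psi]; push_cast; rfl
    have h2 : ((rexp u : ℝ) : ℂ) ^ (-(s + 1)) = Complex.exp (-((s + 1) * u)) := by
      rw [Complex.cpow_def_of_ne_zero (by simp), ← Complex.ofReal_log (exp_pos _).le, log_exp]
      ring_nf
    rw [h1, h2, abs_of_pos (exp_pos _), Complex.real_smul]
    push_cast
    rw [show -((s + 1) * (u : ℂ)) = -u + (-u + -((s - 1) * u)) by ring, Complex.exp_add,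
      Complex.exp_add]
    have : Complex.exp u * Complex.exp (-u) = 1 := by rw [← Complex.exp_add]; simp
    linear_combination (Chebyshev.psi (rexp u) : ℂ) * (Complex.exp (-u) *
      Complex.exp (-((s - 1) * u))) * this
  · refine Asymptotics.IsBigO.of_bound (log 4 + 4) (Eventually.of_forall fun n => ?_)
    have : ∑ k ∈ Icc 1 n, ArithmeticFunction.vonMangoldt k = Chebyshev.psi n := by
      rw [Chebyshev.psi, Nat.floor_natCast]; rfl
    rw [this, rpow_one, norm_of_nonneg (Chebyshev.psi_nonneg _), norm_of_nonneg (by positivity)]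
    exact Chebyshev.psi_le_const_mul_self (by positivity)

open MeasureTheory Topology in
/-- The prime number theorem for the Chebyshev function `ψ`. -/
lemma tendsto_psi_exp : Tendsto (fun u => Chebyshev.psi (exp u) * exp (-u)) atTop (𝓝 1) := by
  set g : ℝ → ℝ := Set.indicator (Set.Ioi 0) fun u => Chebyshev.psi (exp u) * exp (-u) - 1 with hgdef
  have hpsim : Measurable fun u => Chebyshev.psi (exp u) * exp (-u) :=
    (Chebyshev.psi_mono.measurable.comp measurable_exp).mul (by fun_prop)
  have hg : Measurable g := (hpsim.sub_const 1).indicator measurableSet_Ioi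
  have hb0 (u : ℝ) : 0 ≤ Chebyshev.psi (exp u) * exp (-u) :=
    mul_nonneg (Chebyshev.psi_nonneg _) (exp_pos _).le
  have hlog4 : 0 ≤ log 4 := log_nonneg (by norm_num)
  have hb (u : ℝ) : Chebyshev.psi (exp u) * exp (-u) ≤ log 4 + 4 := by
    rw [exp_neg, ← div_eq_mul_inv, div_le_iff₀ (exp_pos _)]
    exact Chebyshev.psi_le_const_mul_self (exp_pos _).le
  set A := ArithmeticFunction.vonMangoldt.LFunctionResidueClassAux (1 : ZMod 1) with hA
  have hAc : ContinuousOn A {s | 1 ≤ s.re} :=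
    ArithmeticFunction.vonMangoldt.continuousOn_LFunctionResidueClassAux (1 : ZMod 1)
  have hAe {s : ℂ} (hs : 1 < s.re) :
      A s = LSeries (fun n => (ArithmeticFunction.vonMangoldt n : ℂ)) s - 1 / (s - 1) := by
    have := ArithmeticFunction.vonMangoldt.eqOn_LFunctionResidueClassAux (q := 1) (a := 1)
      isUnit_one hs
    rw [hA, this]
    simp only [Nat.totient_one, Nat.cast_one, inv_one]
    congr 2
    ext n
    rw [ArithmeticFunction.vonMangoldt.residueClass, Set.indicator_of_mem]
    exact Subsingleton.elim _ _
  have main : Tendsto g atTop (𝓝 0) := by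
    refine tendsto_zero_of_laplace_extends hg (K := log 4 + 4) ?_ ?_
      (G := fun s => (A (s + 1) - 1) / (s + 1)) ?_ ?_ ?_ ?_
    · intro u
      rw [hgdef]
      by_cases hu : u ∈ Set.Ioi (0:ℝ)
      · rw [Set.indicator_of_mem hu, abs_le]
        constructor <;> linarith [hb0 u, hb u]
      · rw [Set.indicator_of_notMem hu, abs_zero]; positivity
    · intro u hu
      exact Set.indicator_of_notMem (by simpa using hu) _
    · refine ContinuousOn.div ((hAc.comp (by fun_prop) ?_).sub continuousOn_const) (by fun_prop) ?_
      · intro s hs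
        simpa using hs
      · intro s hs h
        have : s = -1 := by linear_combination h
        rw [this] at hs
        norm_num at hs
    · intro s hs
      have hs1 : 1 < (s + 1).re := by simpa using hs
      have hs0 : s ≠ 0 := by rintro rfl; simp at hs
      have hs10 : s + 1 ≠ 0 := by intro h; rw [h] at hs1; norm_num at hs1
      have i1 : IntegrableOn (fun u : ℝ => Complex.exp (-(s * u))) (Set.Ioi 0) := by
        have := integrableOn_exp_mul_complex_Ioi (a := -s) (by simpa using hs) 0
        simpa only [neg_mul] using this
      have i2 : IntegrableOn (fun u : ℝ => ((Chebyshev.psi (exp u) * exp (-u) : ℝ) : ℂ) *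
          Complex.exp (-(s * u))) (Set.Ioi 0) := by
        refine i1.bdd_mul (c := log 4 + 4)
          (Complex.measurable_ofReal.comp hpsim).aestronglyMeasurable (ae_of_all _ fun u => ?_)
        rw [Complex.norm_real, norm_of_nonneg (hb0 u)]
        exact hb u
      have e1 : ∫ u, (g u : ℂ) * Complex.exp (-(s * u)) =
          ∫ u in Set.Ioi (0 : ℝ), (((Chebyshev.psi (exp u) * exp (-u) : ℝ) : ℂ) *
            Complex.exp (-(s * u)) - Complex.exp (-(s * u))) := by
        rw [← integral_indicator measurableSet_Ioi]
        congr 1; ext u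
        by_cases hu : u ∈ Set.Ioi (0:ℝ)
        · rw [hgdef, Set.indicator_of_mem hu, Set.indicator_of_mem hu]
          push_cast; ring
        · rw [hgdef, Set.indicator_of_notMem hu, Set.indicator_of_notMem hu]
          simp
      rw [e1, integral_sub i2 i1]
      have e2 := integral_exp_mul_complex_Ioi (a := -s) (by simpa using hs) 0
      simp only [neg_mul] at e2
      rw [e2, hAe hs1, LSeries_vonMangoldt_eq_mul_integral hs1]
      simp only [add_sub_cancel_right, Complex.ofReal_zero, mul_zero, neg_zero, Complex.exp_zero]
      field_simp
      ring
    · intro u v hu huv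
      rw [hgdef, Set.indicator_of_mem (by exact hu), Set.indicator_of_mem (by exact hu.trans_le huv)]
      simp only [sub_add_cancel, mul_assoc, ← exp_add, neg_add_cancel, exp_zero, mul_one]
      exact Chebyshev.psi_mono (exp_le_exp.2 huv)
    · intro u
      rw [hgdef]
      by_cases hu : u ∈ Set.Ioi (0:ℝ)
      · rw [Set.indicator_of_mem hu]; linarith [hb0 u]
      · rw [Set.indicator_of_notMem hu]; norm_num
  have := main.add_const 1
  rw [zero_add] at this
  refine this.congr' ?_
  filter_upwards [eventually_gt_atTop 0] with u hu
  rw [hgdef, Set.indicator_of_mem (by exact hu)]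
  ring

open Topology in
/-- The prime number theorem, with an error term `ε x + O_ε(1)`. -/
lemma exists_abs_theta_sub_le {ε : ℝ} (hε : 0 < ε) :
    ∃ B : ℝ, 0 ≤ B ∧ ∀ x : ℝ, 0 ≤ x → |Chebyshev.theta x - x| ≤ ε * x + B := by
  obtain ⟨D, hD⟩ := Chebyshev.psi_sub_theta_le_mul_sqrt
  have h1 : Tendsto (fun x => Chebyshev.psi x * x⁻¹) atTop (𝓝 1) := by
    refine (tendsto_psi_exp.comp tendsto_log_atTop).congr' ?_
    filter_upwards [eventually_gt_atTop 0] with x hx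
    simp [exp_log hx, exp_neg]
  have h2 : Tendsto (fun x : ℝ => D * (√x)⁻¹) atTop (𝓝 0) := by
    simpa using tendsto_sqrt_atTop.inv_tendsto_atTop.const_mul D
  obtain ⟨X, hX⟩ := eventually_atTop.1 (((h1.eventually
    (Metric.ball_mem_nhds 1 (half_pos hε))).and (h2.eventually (gt_mem_nhds (half_pos hε)))).and
    (eventually_gt_atTop 0))
  have hlog4 : 0 ≤ log 4 := log_nonneg (by norm_num)
  refine ⟨(log 4 + 1) * |X|, by positivity, fun x hx => ?_⟩
  rcases le_total X x with h | h
  · obtain ⟨⟨h3, h4⟩, h5⟩ := hX x h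
    rw [dist_eq, abs_lt] at h3
    have h6 := Chebyshev.theta_le_psi x
    have h7 := hD x
    have h8 : D * √x ≤ ε / 2 * x := by
      have hs := sqrt_pos.2 h5
      rw [← div_eq_mul_inv, div_lt_iff₀ hs] at h4
      nlinarith [mul_self_sqrt h5.le]
    have h9 : Chebyshev.psi x = Chebyshev.psi x * x⁻¹ * x := by field_simp
    have : 0 ≤ (log 4 + 1) * |X| := by positivity
    rw [abs_le]
    constructor <;> nlinarith
  · have h3 := Chebyshev.theta_nonneg x
    have h4 := Chebyshev.theta_le_log4_mul_x hx
    have h5 : x ≤ |X| := h.trans (le_abs_self X)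
    have h6 : (log 4 + 1) * x ≤ (log 4 + 1) * |X| := by gcongr
    have h7 : 0 ≤ ε * x := by positivity
    have h8 : 0 ≤ log 4 * x := by positivity
    rw [abs_le]
    constructor <;> nlinarith

lemma bigOmega_eq_cardFactors (n : ℕ) : bigOmega n = ArithmeticFunction.cardFactors n :=
  ArithmeticFunction.cardFactors_apply.symm

lemma bigOmega_mul {m n : ℕ} (hm : m ≠ 0) (hn : n ≠ 0) :
    bigOmega (m * n) = bigOmega m + bigOmega n := by
  simp only [bigOmega_eq_cardFactors, ArithmeticFunction.cardFactors_mul hm hn]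

lemma bigOmega_prime_pow {p : ℕ} (hp : p.Prime) (a : ℕ) : bigOmega (p ^ a) = a := by
  rw [bigOmega_eq_cardFactors, ArithmeticFunction.cardFactors_apply_prime_pow hp]

lemma bigOmega_one : bigOmega 1 = 0 := by simp [bigOmega]

lemma bigOmega_eq_zero {n : ℕ} (hn : n ≠ 0) : bigOmega n = 0 ↔ n = 1 := by
  rw [bigOmega_eq_cardFactors, ArithmeticFunction.cardFactors_eq_zero_iff_eq_zero_or_one]
  simp [hn]

lemma card_divisors_filter_isPrimePow (n : ℕ) :
    (n.divisors.filter IsPrimePow).card = bigOmega n := by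
  induction n using Nat.recOnPosPrimePosCoprime with
  | prime_pow p n hp hn =>
    rw [bigOmega_prime_pow hp, Nat.divisors_prime_pow hp, filter_map, card_map]
    have : (range (n + 1)).filter (IsPrimePow ∘ fun x => p ^ x) = Icc 1 n := by
      ext x
      simp only [mem_filter, mem_range, Function.comp, mem_Icc]
      constructor
      · rintro ⟨h1, h2⟩
        refine ⟨?_, by omega⟩
        by_contra! h
        have : x = 0 := by omega
        simp [this, not_isPrimePow_one] at h2
      · rintro ⟨h1, h2⟩
        exact ⟨by omega, hp.isPrimePow.pow (by omega)⟩
    have h2 := congrArg Finset.card this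
    simpa using h2
  | zero => simp [bigOmega]
  | one => simp [bigOmega, not_isPrimePow_one]
  | coprime a b ha hb hab iha ihb =>
    rw [Nat.mul_divisors_filter_prime_pow hab, filter_union,
      card_union_of_disjoint (Nat.disjoint_divisors_filter_isPrimePow hab), iha, ihb,
      bigOmega_mul (by omega) (by omega)]

/-- The Dirichlet series of the integers with exactly `k` prime factors. -/
noncomputable def omegaSeries (σ : ℝ) (k : ℕ) : ℝ :=
  ∑' n : ℕ, if bigOmega n = k then (n : ℝ) ^ (-σ) else 0

/-- The Dirichlet series of the `a`-th powers of primes. -/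
noncomputable def primeZeta (σ : ℝ) (a : ℕ) : ℝ :=
  ∑' p : Nat.Primes, (((p : ℕ) : ℝ) ^ (-σ)) ^ a

lemma summable_ite_rpow {σ : ℝ} (hσ : 1 < σ) (P : ℕ → Prop) [DecidablePred P] :
    Summable fun n : ℕ => if P n then (n : ℝ) ^ (-σ) else 0 := by
  refine Summable.of_nonneg_of_le (fun n => ?_) (fun n => ?_)
    (Real.summable_nat_rpow.2 (by linarith : -σ < -1))
  · split_ifs <;> positivity
  · split_ifs
    · exact le_rfl
    · positivity

lemma zero_rpow_neg {σ : ℝ} (hσ : 1 < σ) : ((0 : ℕ) : ℝ) ^ (-σ) = 0 := by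
  rw [Nat.cast_zero, Real.zero_rpow (by linarith)]

open Classical in
lemma primeZeta_eq_tsum (σ : ℝ) {a : ℕ} (ha : a ≠ 0) :
    primeZeta σ a = ∑' d : ℕ, if IsPrimePow d ∧ bigOmega d = a then (d : ℝ) ^ (-σ) else 0 := by
  have hinj : Function.Injective fun p : Nat.Primes => (p : ℕ) ^ a := by
    intro p q h
    exact Subtype.ext (Nat.pow_left_injective ha h)
  rw [← hinj.tsum_eq]
  · refine tsum_congr fun p => ?_
    rw [if_pos ⟨p.2.isPrimePow.pow ha, bigOmega_prime_pow p.2 a⟩, Nat.cast_pow,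
      ← Real.rpow_natCast, ← Real.rpow_natCast, ← Real.rpow_mul (by positivity),
      ← Real.rpow_mul (by positivity), mul_comm]
  · intro d hd
    rw [Function.mem_support] at hd
    have h := (ite_ne_right_iff.1 hd).1
    obtain ⟨p, k, hp, hk, rfl⟩ := (isPrimePow_nat_iff d).1 h.1
    rw [bigOmega_prime_pow hp] at h
    exact ⟨⟨p, hp⟩, by simp [h.2]⟩

open Classical in
/-- Newton's identity for the complete homogeneous symmetric functions `omegaSeries σ k` of the
numbers `p ^ (-σ)`. -/
lemma omegaSeries_newton {σ : ℝ} (hσ : 1 < σ) (k : ℕ) :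
    (k + 1) * omegaSeries σ (k + 1) =
      ∑ ab ∈ antidiagonal k, primeZeta σ (ab.1 + 1) * omegaSeries σ ab.2 := by
  set F : ℕ × ℕ → ℝ := fun z =>
    if IsPrimePow z.1 ∧ bigOmega z.1 + bigOmega z.2 = k + 1 then
      (z.1 : ℝ) ^ (-σ) * (z.2 : ℝ) ^ (-σ) else 0 with hF
  have hterm (ab : ℕ × ℕ) : HasSum (fun z : ℕ × ℕ =>
      (if IsPrimePow z.1 ∧ bigOmega z.1 = ab.1 + 1 then (z.1 : ℝ) ^ (-σ) else 0) *
        (if bigOmega z.2 = ab.2 then (z.2 : ℝ) ^ (-σ) else 0))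
      (primeZeta σ (ab.1 + 1) * omegaSeries σ ab.2) := by
    have s1 := summable_ite_rpow hσ (fun d => IsPrimePow d ∧ bigOmega d = ab.1 + 1)
    have s2 := summable_ite_rpow hσ (fun d => bigOmega d = ab.2)
    have s3 := s1.mul_of_nonneg s2
      (fun n => by dsimp only; split_ifs <;> [positivity; exact le_rfl])
      (fun n => by dsimp only; split_ifs <;> [positivity; exact le_rfl])
    rw [primeZeta_eq_tsum σ (by omega), omegaSeries, s1.tsum_mul_tsum s2 s3]
    exact s3.hasSum
  have hFsum : HasSum F
      (∑ ab ∈ antidiagonal k, primeZeta σ (ab.1 + 1) * omegaSeries σ ab.2) := by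
    convert hasSum_sum (s := antidiagonal k) fun ab _ => hterm ab using 1
    funext z
    simp only [hF]
    by_cases h : IsPrimePow z.1 ∧ bigOmega z.1 + bigOmega z.2 = k + 1
    · have h1 : bigOmega z.1 ≠ 0 := by
        obtain ⟨p, j, hp, hj, hpj⟩ := (isPrimePow_nat_iff z.1).1 h.1
        rw [← hpj, bigOmega_prime_pow hp]; omega
      rw [if_pos h, Finset.sum_eq_single (bigOmega z.1 - 1, bigOmega z.2)]
      · rw [if_pos ⟨h.1, by dsimp only; omega⟩, if_pos rfl]
      · rintro ⟨a, b⟩ - hne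
        by_cases hb : bigOmega z.2 = b
        · rw [if_neg, zero_mul]
          rintro ⟨-, ha⟩
          refine hne (Prod.ext ?_ hb.symm)
          dsimp only at ha ⊢
          omega
        · rw [if_neg hb, mul_zero]
      · intro hn
        exact absurd (HasAntidiagonal.mem_antidiagonal.2 (by dsimp only; omega)) hn
    · rw [if_neg h, Finset.sum_eq_zero]
      rintro ⟨a, b⟩ hab
      rw [HasAntidiagonal.mem_antidiagonal] at hab
      dsimp only at hab ⊢
      by_cases hb : bigOmega z.2 = b
      · rw [if_neg, zero_mul]
        rintro ⟨h1, h2⟩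
        exact h ⟨h1, by omega⟩
      · rw [if_neg hb, mul_zero]
  have hfib := hFsum.tsum_fiberwise fun z => z.1 * z.2
  have hfib2 (n : ℕ) : ∑' z : ((fun z : ℕ × ℕ => z.1 * z.2) ⁻¹' {n}), F z =
      (k + 1) * if bigOmega n = k + 1 then (n : ℝ) ^ (-σ) else 0 := by
    rcases eq_or_ne n 0 with rfl | hn
    · rw [zero_rpow_neg hσ, ite_self, mul_zero]
      refine (tsum_congr fun z => ?_).trans tsum_zero
      have hz : z.1.1 * z.1.2 = 0 := z.2
      simp only [hF]
      rcases mul_eq_zero.1 hz with h | h <;> rw [h, zero_rpow_neg hσ] <;> simp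
    · have hset : (fun z : ℕ × ℕ => z.1 * z.2) ⁻¹' {n} = ↑(n.divisorsAntidiagonal) := by
        ext z; simp [hn]
      rw [hset, Finset.tsum_subtype' n.divisorsAntidiagonal F]
      have h1 : ∀ z ∈ n.divisorsAntidiagonal, F z =
          if IsPrimePow z.1 then (if bigOmega n = k + 1 then (n : ℝ) ^ (-σ) else 0) else 0 := by
        intro z hz
        rw [Nat.mem_divisorsAntidiagonal] at hz
        have hz1 : z.1 ≠ 0 := by rintro h; simp [h] at hz; omega
        have hz2 : z.2 ≠ 0 := by rintro h; simp [h] at hz; omega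
        simp only [hF]
        rw [← bigOmega_mul hz1 hz2, hz.1, ite_and, ← hz.1, Nat.cast_mul,
          Real.mul_rpow (by positivity) (by positivity)]
      rw [sum_congr rfl h1, Nat.sum_divisorsAntidiagonal fun d _ => if IsPrimePow d then
        (if bigOmega n = k + 1 then (n : ℝ) ^ (-σ) else 0) else 0, ← sum_filter,
      sum_const, card_divisors_filter_isPrimePow, nsmul_eq_mul]
      split_ifs with h
      · rw [h]; push_cast; ring
      · simp
  simp_rw [hfib2] at hfib
  rw [omegaSeries, ← tsum_mul_left, hfib.tsum_eq]

lemma coeff_rescale_exp (c : ℝ) (n : ℕ) :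
    (PowerSeries.coeff n) (PowerSeries.rescale c (PowerSeries.exp ℝ)) = c ^ n / n.factorial := by
  rw [PowerSeries.coeff_rescale, PowerSeries.coeff_exp]
  simp [div_eq_mul_inv]

lemma derivative_rescale_exp (c : ℝ) :
    PowerSeries.derivative ℝ (PowerSeries.rescale c (PowerSeries.exp ℝ)) =
      PowerSeries.C c * PowerSeries.rescale c (PowerSeries.exp ℝ) := by
  ext n
  rw [PowerSeries.coeff_derivative, PowerSeries.coeff_C_mul, coeff_rescale_exp, coeff_rescale_exp,
    Nat.factorial_succ]
  push_cast
  field_simp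
  ring

/-- A sequence satisfying Newton's recursion with power sums `p` factors as the convolution of
the exponential sequence `p 0 ^ j / j!` with a sequence built from the higher power sums. -/
lemma exists_exp_factor {s p : ℕ → ℝ} (hs0 : s 0 = 1)
    (hs : ∀ k : ℕ, (k + 1) * s (k + 1) = ∑ ab ∈ antidiagonal k, p ab.1 * s ab.2) :
    ∃ h : ℕ → ℝ, h 0 = 1 ∧
      (∀ n : ℕ, (n + 1) * h (n + 1) =
        ∑ ab ∈ antidiagonal n, (if ab.1 = 0 then 0 else p ab.1) * h ab.2) ∧
      ∀ k, s k = ∑ ab ∈ antidiagonal k, h ab.1 * (p 0 ^ ab.2 / (ab.2).factorial) := by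
  set S := PowerSeries.mk s with hS
  set Q := PowerSeries.mk p with hQ
  set E := fun c : ℝ => PowerSeries.rescale c (PowerSeries.exp ℝ) with hE
  have hdS : PowerSeries.derivative ℝ S = Q * S := by
    ext n
    rw [PowerSeries.coeff_derivative, PowerSeries.coeff_mul]
    simp only [hS, hQ, PowerSeries.coeff_mk]
    rw [mul_comm, hs]
  have hEE : E (-(p 0)) * E (p 0) = 1 := by
    simp only [hE]
    rw [PowerSeries.exp_mul_exp_eq_exp_add, neg_add_cancel, PowerSeries.rescale_zero]
    simp
  set H := S * E (-(p 0)) with hH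
  have hdH : PowerSeries.derivative ℝ H = (Q - PowerSeries.C (p 0)) * H := by
    rw [hH, Derivation.leibniz, hdS, derivative_rescale_exp]
    simp only [smul_eq_mul, map_neg]
    ring
  refine ⟨fun n => PowerSeries.coeff n H, ?_, fun n => ?_, fun k => ?_⟩
  · simp [hH, PowerSeries.coeff_mul, hE, hS, hs0, -PowerSeries.coeff_zero_eq_constantCoeff]
  · have := congrArg (PowerSeries.coeff n) hdH
    rw [PowerSeries.coeff_derivative] at this
    rw [mul_comm, this, PowerSeries.coeff_mul]
    refine sum_congr rfl fun ab _ => ?_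
    rw [map_sub, PowerSeries.coeff_C, hQ, PowerSeries.coeff_mk]
    split_ifs with h
    · rw [h, sub_self]
    · rw [sub_zero]
  · have h1 : S = H * E (p 0) := by rw [hH, mul_assoc, hEE, mul_one]
    have := congrArg (PowerSeries.coeff k) h1
    rw [PowerSeries.coeff_mul, hS, PowerSeries.coeff_mk] at this
    rw [this]
    exact sum_congr rfl fun ab _ => by rw [coeff_rescale_exp]

lemma geometric_bound_of_newton {h p : ℕ → ℝ} {D : ℝ} (hD : 0 ≤ D) (h0 : h 0 = 1)
    (hp0 : ∀ a, 0 ≤ p a) (hp : ∀ a, p a ≤ D * (1 / 2) ^ a)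
    (hh : ∀ n : ℕ, (n + 1) * h (n + 1) = ∑ ab ∈ antidiagonal n, p ab.1 * h ab.2) (n : ℕ) :
    0 ≤ h n ∧ h n ≤ (1 + D * (10 / 3)) ^ min n ⌈D * (10 / 3)⌉₊ * (4 / 5) ^ n := by
  set K := D * (10 / 3) with hK
  have hK0 : 0 ≤ K := by positivity
  induction n using Nat.strong_induction_on with
  | _ n ih =>
    rcases n with _ | n
    · simp [h0]
    · have hpos : (0 : ℝ) < n + 1 := by positivity
      have e1 : h (n + 1) = (∑ ab ∈ antidiagonal n, p ab.1 * h ab.2) / (n + 1) := by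
        rw [← hh n]; field_simp
      have hle {ab : ℕ × ℕ} (hab : ab ∈ antidiagonal n) : ab.2 ≤ n := by
        rw [HasAntidiagonal.mem_antidiagonal] at hab; omega
      constructor
      · rw [e1]
        exact div_nonneg (sum_nonneg fun ab hab =>
          mul_nonneg (hp0 _) (ih _ (Nat.lt_succ_of_le (hle hab))).1) hpos.le
      · set M := (1 + K) ^ min n ⌈K⌉₊ with hM
        have hM0 : 0 ≤ M := by positivity
        have hsum : ∑ ab ∈ antidiagonal n, p ab.1 * h ab.2 ≤ K * M * (4 / 5) ^ (n + 1) := by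
          calc ∑ ab ∈ antidiagonal n, p ab.1 * h ab.2
              ≤ ∑ ab ∈ antidiagonal n, D * M * (4 / 5) ^ n * (5 / 8) ^ ab.1 := by
                refine sum_le_sum fun ab hab => ?_
                have h2 := (ih _ (Nat.lt_succ_of_le (hle hab))).2
                have h3 := (ih _ (Nat.lt_succ_of_le (hle hab))).1
                have h4 : (1 + K) ^ min ab.2 ⌈K⌉₊ ≤ M :=
                  pow_le_pow_right₀ (by linarith) (min_le_min_right _ (hle hab))
                have h5 : (4 / 5 : ℝ) ^ n = (4 / 5) ^ ab.1 * (4 / 5) ^ ab.2 := by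
                  rw [← pow_add, HasAntidiagonal.mem_antidiagonal.1 hab]
                calc p ab.1 * h ab.2 ≤ (D * (1 / 2) ^ ab.1) * (M * (4 / 5) ^ ab.2) := by
                      refine mul_le_mul (hp _) (h2.trans ?_) h3 (by positivity)
                      gcongr
                  _ = D * M * (4 / 5) ^ n * (5 / 8) ^ ab.1 := by
                      rw [h5, show (1 / 2 : ℝ) = 4 / 5 * (5 / 8) by norm_num, mul_pow]
                      ring
            _ = D * M * (4 / 5) ^ n * ∑ a ∈ range (n + 1), (5 / 8 : ℝ) ^ a := by
                rw [← mul_sum, Finset.Nat.sum_antidiagonal_eq_sum_range_succ_mk]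
            _ ≤ D * M * (4 / 5) ^ n * (8 / 3) := by
                refine mul_le_mul_of_nonneg_left ?_ (by positivity)
                refine ((summable_geometric_of_lt_one (by norm_num)
                  (by norm_num : (5 / 8 : ℝ) < 1)).sum_le_tsum _ fun _ _ => by positivity).trans ?_
                rw [tsum_geometric_of_lt_one (by norm_num) (by norm_num)]
                norm_num
            _ = K * M * (4 / 5) ^ (n + 1) := by rw [hK, pow_succ]; ring
        rw [e1, div_le_iff₀ hpos]
        refine hsum.trans ?_
        have h6 : K * M ≤ (1 + K) ^ min (n + 1) ⌈K⌉₊ * (n + 1) := by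
          by_cases hc : n + 1 ≤ ⌈K⌉₊
          · rw [hM, min_eq_left hc, min_eq_left (by omega), pow_succ]
            have : 0 ≤ (1 + K) ^ n := by positivity
            calc K * (1 + K) ^ n ≤ (1 + K) ^ n * (1 + K) * 1 := by nlinarith
              _ ≤ _ := by
                refine mul_le_mul_of_nonneg_left ?_ (by positivity)
                linarith [(Nat.cast_nonneg n : (0 : ℝ) ≤ n)]
          · rw [hM, min_eq_right (by omega), min_eq_right (by omega), mul_comm]
            refine mul_le_mul_of_nonneg_left ((Nat.le_ceil K).trans ?_) (by positivity)
            exact_mod_cast (by omega : ⌈K⌉₊ ≤ n + 1)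
        calc K * M * (4 / 5) ^ (n + 1)
            ≤ (1 + K) ^ min (n + 1) ⌈K⌉₊ * (n + 1) * (4 / 5) ^ (n + 1) := by gcongr
          _ = _ := by ring

lemma omegaSeries_zero (σ : ℝ) (hσ : 1 < σ) : omegaSeries σ 0 = 1 := by
  rw [omegaSeries, tsum_eq_single 1]
  · simp [bigOmega_one]
  · intro n hn
    rcases eq_or_ne n 0 with rfl | h0
    · rw [zero_rpow_neg hσ, ite_self]
    · rw [if_neg]
      rwa [bigOmega_eq_zero h0]

lemma primeZeta_nonneg (σ : ℝ) (a : ℕ) : 0 ≤ primeZeta σ a :=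
  tsum_nonneg fun p => by positivity

lemma primeZeta_le {σ : ℝ} (hσ : 1 < σ) {a : ℕ} (ha : a ≠ 0) :
    primeZeta σ (a + 1) ≤
      (2 * ∑' p : Nat.Primes, ((p : ℕ) : ℝ) ^ (-2 : ℝ)) * (1 / 2) ^ a := by
  have hs : Summable fun p : Nat.Primes => ((p : ℕ) : ℝ) ^ (-2 : ℝ) :=
    Nat.Primes.summable_rpow.2 (by norm_num)
  have hterm (p : Nat.Primes) : (((p : ℕ) : ℝ) ^ (-σ)) ^ (a + 1) ≤
      2 * (1 / 2) ^ a * ((p : ℕ) : ℝ) ^ (-2 : ℝ) := by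
    have hp2 : (2 : ℝ) ≤ (p : ℕ) := by exact_mod_cast p.2.two_le
    have h1 : ((p : ℕ) : ℝ) ^ (-σ) ≤ ((p : ℕ) : ℝ)⁻¹ := by
      rw [← Real.rpow_neg_one]
      exact Real.rpow_le_rpow_of_exponent_le (by linarith) (by linarith)
    have h2 : ((p : ℕ) : ℝ)⁻¹ ≤ 1 / 2 := by
      rw [one_div]; exact inv_anti₀ (by norm_num) hp2
    have h3 : ((p : ℕ) : ℝ) ^ (-2 : ℝ) = ((p : ℕ) : ℝ)⁻¹ ^ 2 := by
      rw [Real.rpow_neg (by positivity), inv_pow]; norm_num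
    obtain ⟨b, rfl⟩ := Nat.exists_eq_succ_of_ne_zero ha
    rw [h3]
    calc (((p : ℕ) : ℝ) ^ (-σ)) ^ (b + 1 + 1) ≤ ((p : ℕ) : ℝ)⁻¹ ^ (b + 1 + 1) := by gcongr
      _ = ((p : ℕ) : ℝ)⁻¹ ^ b * ((p : ℕ) : ℝ)⁻¹ ^ 2 := by ring
      _ ≤ (1 / 2) ^ b * ((p : ℕ) : ℝ)⁻¹ ^ 2 := by gcongr
      _ = _ := by rw [Nat.succ_eq_add_one, pow_succ]; ring
  have hs2 := hs.mul_left (2 * (1 / 2) ^ a)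
  calc primeZeta σ (a + 1) ≤ ∑' p : Nat.Primes, 2 * (1 / 2) ^ a * ((p : ℕ) : ℝ) ^ (-2 : ℝ) :=
        (Summable.of_nonneg_of_le (fun p => by positivity) hterm hs2).tsum_le_tsum hterm hs2
    _ = _ := by rw [tsum_mul_left]; ring

/-- The total mass of the series `omegaSeries σ` is `ζ(σ)`. -/
lemma hasSum_omegaSeries {σ : ℝ} (hσ : 1 < σ) :
    HasSum (omegaSeries σ) (∑' n : ℕ, (n : ℝ) ^ (-σ)) := by
  have hs : Summable fun n : ℕ => (n : ℝ) ^ (-σ) := Real.summable_nat_rpow.2 (by linarith)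
  convert! hs.hasSum.tsum_fiberwise bigOmega using 1
  funext k
  rw [omegaSeries, _root_.tsum_subtype (bigOmega ⁻¹' {k}) fun n : ℕ => (n : ℝ) ^ (-σ)]
  refine tsum_congr fun n => ?_
  by_cases h : bigOmega n = k <;> simp [Set.indicator, h]

theorem exists_omegaSeries_factor : ∃ M : ℝ, 0 ≤ M ∧ ∀ σ : ℝ, 1 < σ → ∃ h : ℕ → ℝ, h 0 = 1 ∧
    (∀ n, 0 ≤ h n) ∧ (∀ n, h n ≤ M * (4 / 5) ^ n) ∧
    (∀ k, omegaSeries σ k =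
      ∑ ab ∈ antidiagonal k, h ab.1 * (primeZeta σ 1 ^ ab.2 / (ab.2).factorial)) ∧
    ∑' n : ℕ, (n : ℝ) ^ (-σ) = (∑' n, h n) * exp (primeZeta σ 1) := by
  set D := 2 * ∑' p : Nat.Primes, ((p : ℕ) : ℝ) ^ (-2 : ℝ) with hDdef
  have hD : 0 ≤ D := mul_nonneg zero_le_two (tsum_nonneg fun p => by positivity)
  refine ⟨(1 + D * (10 / 3)) ^ ⌈D * (10 / 3)⌉₊, by positivity, fun σ hσ => ?_⟩
  obtain ⟨h, h0, hrec, hconv⟩ := exists_exp_factor (p := fun a => primeZeta σ (a + 1))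
    (omegaSeries_zero σ hσ) (omegaSeries_newton hσ)
  have hb := geometric_bound_of_newton (p := fun a => if a = 0 then 0 else primeZeta σ (a + 1))
    hD h0 (fun a => by split_ifs <;> [exact le_rfl; exact primeZeta_nonneg _ _])
    (fun a => by split_ifs with ha <;> [positivity; exact primeZeta_le hσ ha]) hrec
  have hle (n : ℕ) : h n ≤ (1 + D * (10 / 3)) ^ ⌈D * (10 / 3)⌉₊ * (4 / 5) ^ n := by
    refine (hb n).2.trans ?_
    gcongr
    · linarith [show 0 ≤ D * (10 / 3) by positivity]
    · exact min_le_right _ _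
  have hsum : Summable h := Summable.of_nonneg_of_le (fun n => (hb n).1) hle
    ((summable_geometric_of_lt_one (by norm_num) (by norm_num)).mul_left _)
  refine ⟨h, h0, fun n => (hb n).1, hle, hconv, ?_⟩
  have hexp := NormedSpace.expSeries_div_hasSum_exp (primeZeta σ 1)
  rw [← Real.exp_eq_exp_ℝ] at hexp
  rw [← hexp.tsum_eq, tsum_mul_tsum_eq_tsum_sum_antidiagonal_of_summable_norm hsum.norm
    hexp.summable.norm, ← (hasSum_omegaSeries hσ).tsum_eq]
  exact tsum_congr hconv

lemma tendsto_descFactorial_div_pow {ι : Type*} {l : Filter ι} {P : ι → ℝ} {k : ι → ℕ}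
    (hP : Tendsto P l atTop) (hk : Tendsto (fun i => (k i : ℝ) / P i) l (nhds 1)) (j : ℕ) :
    Tendsto (fun i => ((k i).descFactorial j : ℝ) / P i ^ j) l (nhds 1) := by
  induction j with
  | zero => simpa using tendsto_const_nhds
  | succ j ih =>
    have hk' : Tendsto k l atTop := by
      have := hk.pos_mul_atTop one_pos hP
      refine tendsto_natCast_atTop_iff.1 (this.congr' ?_)
      filter_upwards [hP.eventually_gt_atTop 0] with i hi
      field_simp
    have h1 : Tendsto (fun i => ((k i - j : ℕ) : ℝ) / P i) l (nhds 1) := by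
      have := hk.sub (tendsto_const_nhds (x := (j : ℝ)).div_atTop hP)
      rw [sub_zero] at this
      refine this.congr' ?_
      filter_upwards [hk'.eventually_ge_atTop j] with i hi
      rw [Nat.cast_sub hi, sub_div]
    have := h1.mul ih
    rw [one_mul] at this
    refine this.congr fun i => ?_
    rw [Nat.descFactorial_succ, Nat.cast_mul, pow_succ', div_mul_div_comm]

lemma sum_antidiagonal_mul_exp_term (h : ℕ → ℝ) {P : ℝ} (hP : 0 < P) (k : ℕ) :
    ∑ ab ∈ antidiagonal k, h ab.1 * (P ^ ab.2 / (ab.2).factorial) =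
      P ^ k / k.factorial * ∑' j, h j * ((k.descFactorial j : ℝ) / P ^ j) := by
  rw [Finset.Nat.sum_antidiagonal_eq_sum_range_succ_mk, ← tsum_mul_left,
    tsum_eq_sum (s := range (k + 1))]
  · refine sum_congr rfl fun j hj => ?_
    have hj : j ≤ k := by rw [mem_range] at hj; omega
    have h1 : P ^ k = P ^ (k - j) * P ^ j := by rw [← pow_add, Nat.sub_add_cancel hj]
    have h2 : (k.factorial : ℝ) = (k - j).factorial * k.descFactorial j := by
      exact_mod_cast (Nat.factorial_mul_descFactorial hj).symm
    have h3 : (k.descFactorial j : ℝ) ≠ 0 := by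
      rw [Nat.cast_ne_zero, Ne, Nat.descFactorial_eq_zero_iff_lt]; omega
    dsimp only
    rw [h1, h2]
    field_simp
  · intro j hj
    rw [Nat.descFactorial_eq_zero_iff_lt.2 (by rw [mem_range] at hj; omega)]
    simp

/-- Local limit theorem for the Dirichlet weights: the mass of `Ω = k` is asymptotically the
Poisson mass with parameter the prime zeta function, in the range `k ∼ P`. -/
theorem tendsto_omegaSeries_ratio {ι : Type*} {l : Filter ι} {σ : ι → ℝ} {k : ι → ℕ}
    (hσ : ∀ᶠ i in l, 1 < σ i) (hP : Tendsto (fun i => primeZeta (σ i) 1) l atTop)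
    (hk : Tendsto (fun i => (k i : ℝ) / primeZeta (σ i) 1) l (nhds 1)) :
    Tendsto (fun i => omegaSeries (σ i) (k i) / ((∑' n : ℕ, (n : ℝ) ^ (-σ i)) *
      (exp (-primeZeta (σ i) 1) * (primeZeta (σ i) 1 ^ k i / (k i).factorial)))) l (nhds 1) := by
  obtain ⟨M, hM, hfac⟩ := exists_omegaSeries_factor
  have hfac' : ∀ σ : ℝ, ∃ h : ℕ → ℝ, 1 < σ → h 0 = 1 ∧
      (∀ n, 0 ≤ h n) ∧ (∀ n, h n ≤ M * (4 / 5) ^ n) ∧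
      (∀ k, omegaSeries σ k =
        ∑ ab ∈ antidiagonal k, h ab.1 * (primeZeta σ 1 ^ ab.2 / (ab.2).factorial)) ∧
      ∑' n : ℕ, (n : ℝ) ^ (-σ) = (∑' n, h n) * exp (primeZeta σ 1) := by
    intro σ
    by_cases h : 1 < σ
    · obtain ⟨g, hg⟩ := hfac σ h
      exact ⟨g, fun _ => hg⟩
    · exact ⟨0, fun h' => absurd h' h⟩
  choose h hh using hfac'
  set P := fun i => primeZeta (σ i) 1 with hPdef
  set ρ := fun i j => ((k i).descFactorial j : ℝ) / P i ^ j with hρ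
  have hgeo : Summable fun j : ℕ => M * (4 / 5) ^ j * (11 / 10 : ℝ) ^ j := by
    have : (fun j : ℕ => M * (4 / 5) ^ j * (11 / 10 : ℝ) ^ j) = fun j => M * (22 / 25) ^ j := by
      funext j
      rw [mul_assoc, ← mul_pow]; norm_num
    rw [this]
    exact (summable_geometric_of_lt_one (by norm_num) (by norm_num)).mul_left _
  have hρb : ∀ᶠ i in l, ∀ j, 0 ≤ ρ i j ∧ ρ i j ≤ (11 / 10) ^ j := by
    filter_upwards [hP.eventually_gt_atTop 0,
      hk.eventually_le_const (by norm_num : (1 : ℝ) < 11 / 10)] with i h1 h2 j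
    have h1' : 0 < P i := h1
    refine ⟨by positivity, ?_⟩
    calc ρ i j ≤ (k i : ℝ) ^ j / P i ^ j := by
          simp only [hρ]
          gcongr
          exact_mod_cast Nat.descFactorial_le_pow _ _
      _ = ((k i : ℝ) / P i) ^ j := by rw [div_pow]
      _ ≤ _ := by gcongr
  have hR : Tendsto (fun i => ∑' j, h (σ i) j * (ρ i j - 1)) l (nhds 0) := by
    rw [← tsum_zero (β := ℕ)]
    refine tendsto_tsum_of_dominated_convergence hgeo (fun j => ?_) ?_
    · have h1 := (tendsto_descFactorial_div_pow hP hk j).sub_const 1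
      rw [sub_self] at h1
      have h2 := h1.abs.const_mul (M * (4 / 5) ^ j)
      rw [abs_zero, mul_zero] at h2
      refine squeeze_zero_norm' ?_ h2
      filter_upwards [hσ] with i hi
      rw [norm_mul, Real.norm_eq_abs, Real.norm_eq_abs, abs_of_nonneg ((hh _ hi).2.1 j)]
      exact mul_le_mul_of_nonneg_right ((hh _ hi).2.2.1 j) (abs_nonneg _)
    · filter_upwards [hσ, hρb] with i hi hb j
      rw [norm_mul, Real.norm_eq_abs, Real.norm_eq_abs, abs_of_nonneg ((hh _ hi).2.1 j)]
      refine mul_le_mul ((hh _ hi).2.2.1 j) ?_ (abs_nonneg _) (by positivity)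
      have h1 : (1 : ℝ) ≤ (11 / 10) ^ j := one_le_pow₀ (by norm_num)
      rw [abs_le]
      constructor <;> linarith [(hb j).1, (hb j).2]
  rw [← tendsto_sub_nhds_zero_iff]
  refine squeeze_zero_norm' ?_ (by simpa using hR.abs)
  filter_upwards [hσ, hρb, hP.eventually_gt_atTop 0] with i hi hb hPi
  obtain ⟨h0, hpos, hle, hconv, hz⟩ := hh _ hi
  have hs : Summable (h (σ i)) := Summable.of_nonneg_of_le hpos hle
    ((summable_geometric_of_lt_one (by norm_num) (by norm_num)).mul_left _)
  have hs2 : Summable fun j => h (σ i) j * ρ i j :=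
    Summable.of_nonneg_of_le (fun j => mul_nonneg (hpos j) (hb j).1)
      (fun j => mul_le_mul (hle j) (hb j).2 (hb j).1 (by positivity)) hgeo
  have h1 : 1 ≤ ∑' j, h (σ i) j := by
    rw [← h0]; exact hs.le_tsum 0 fun j _ => hpos j
  have h2 : ∑' j, h (σ i) j * (ρ i j - 1) = ∑' j, h (σ i) j * ρ i j - ∑' j, h (σ i) j := by
    rw [← hs2.tsum_sub hs]
    exact tsum_congr fun j => by ring
  have hPi' : 0 < primeZeta (σ i) 1 := hPi
  have h3 : omegaSeries (σ i) (k i) / ((∑' n : ℕ, (n : ℝ) ^ (-σ i)) *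
      (exp (-P i) * (P i ^ k i / (k i).factorial))) - 1 =
      (∑' j, h (σ i) j * (ρ i j - 1)) / ∑' j, h (σ i) j := by
    rw [h2, hconv, sum_antidiagonal_mul_exp_term _ hPi', hz, exp_neg]
    have e1 := (exp_pos (primeZeta (σ i) 1)).ne'
    have e2 : ∑' j, h (σ i) j ≠ 0 := by positivity
    have e3 : ((k i).factorial : ℝ) ≠ 0 := by positivity
    simp only [hρ, hPdef]
    field_simp
  rw [h3, norm_div, Real.norm_eq_abs, Real.norm_eq_abs,
    abs_of_nonneg (by linarith : 0 ≤ ∑' j, h (σ i) j)]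
  exact div_le_self (abs_nonneg _) h1

lemma poisson_exponent_bound {B C s k P : ℝ} (hB : 0 ≤ B) (hC : 1 ≤ C) (hsB : B ≤ s)
    (hsC : 4 * (C + 1) ≤ s) (hk : |k - s ^ 2| ≤ C * s) (hP : |P - s ^ 2| ≤ B) :
    |k - P + k * log (P / k) + (k - s ^ 2) ^ 2 / (2 * s ^ 2)| ≤
      (8 * (C + 1) ^ 3 + 2 * (C + 1) * B + C ^ 3) / s := by
  have hs : 0 < s := by linarith
  set A := C + 1 with hA
  have hkl : s ^ 2 / 2 ≤ k := by
    have := (abs_le.1 hk).1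
    nlinarith
  have hk0 : 0 < k := by nlinarith [sq_pos_of_pos hs]
  have hPk : |P - k| ≤ A * s := by
    calc |P - k| = |(P - s ^ 2) - (k - s ^ 2)| := by ring_nf
      _ ≤ B + C * s := (abs_sub _ _).trans (add_le_add hP hk)
      _ ≤ A * s := by rw [hA]; linarith
  set t := (P - k) / k with ht
  have ht2 : |t| ≤ 2 * A / s := by
    rw [ht, abs_div, abs_of_pos hk0, div_le_div_iff₀ hk0 hs]
    calc |P - k| * s ≤ A * s * s := by gcongr
      _ = 2 * A * (s ^ 2 / 2) := by ring
      _ ≤ 2 * A * k := by gcongr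
  have ht3 : |t| ≤ 1 / 2 := ht2.trans (by rw [div_le_iff₀ hs]; linarith)
  have hlog : |log (1 + t) - t + t ^ 2 / 2| ≤ 2 * |t| ^ 3 := by
    have h := Real.abs_log_sub_add_sum_range_le (x := -t) (by rw [abs_neg]; linarith) 2
    rw [abs_neg] at h
    simp only [sum_range_succ, range_zero, sum_empty] at h
    have e : log (1 + t) - t + t ^ 2 / 2 = 0 + (-t) ^ (0 + 1) / ((0 : ℕ) + 1) +
        (-t) ^ (1 + 1) / ((1 : ℕ) + 1) + log (1 - -t) := by
      push_cast; ring_nf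
    rw [e]
    refine h.trans ?_
    rw [div_le_iff₀ (by linarith)]
    calc |t| ^ (2 + 1) = 2 * |t| ^ 3 * (1 / 2) := by ring
      _ ≤ 2 * |t| ^ 3 * (1 - |t|) := by gcongr; linarith
  have hPkt : P / k = 1 + t := by rw [ht]; field_simp; ring
  have e : k - P + k * log (P / k) + (k - s ^ 2) ^ 2 / (2 * s ^ 2) =
      k * (log (1 + t) - t + t ^ 2 / 2) - (P - s ^ 2) * ((P - k) - (k - s ^ 2)) / (2 * k) +
        (k - s ^ 2) ^ 2 * (k - s ^ 2) / (2 * k * s ^ 2) := by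
    rw [hPkt, ht]; field_simp; ring
  have b1 : |k * (log (1 + t) - t + t ^ 2 / 2)| ≤ 8 * A ^ 3 / s := by
    rw [abs_mul, abs_of_pos hk0]
    calc k * |log (1 + t) - t + t ^ 2 / 2| ≤ k * (2 * |t| ^ 3) := by gcongr
      _ = 2 * |P - k| * |t| ^ 2 := by
        rw [ht, abs_div, abs_of_pos hk0]; field_simp
      _ ≤ 2 * (A * s) * (2 * A / s) ^ 2 := by gcongr
      _ = 8 * A ^ 3 / s := by field_simp; ring
  have b2 : |(P - s ^ 2) * ((P - k) - (k - s ^ 2)) / (2 * k)| ≤ 2 * A * B / s := by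
    rw [abs_div, abs_mul, abs_of_pos (by linarith : 0 < 2 * k), div_le_div_iff₀ (by linarith) hs]
    have : |(P - k) - (k - s ^ 2)| ≤ 2 * A * s :=
      (abs_sub _ _).trans (by nlinarith)
    calc |P - s ^ 2| * |(P - k) - (k - s ^ 2)| * s ≤ B * (2 * A * s) * s := by gcongr
      _ = 2 * A * B * (2 * (s ^ 2 / 2)) := by ring
      _ ≤ 2 * A * B * (2 * k) := by gcongr
  have b3 : |(k - s ^ 2) ^ 2 * (k - s ^ 2) / (2 * k * s ^ 2)| ≤ C ^ 3 / s := by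
    rw [abs_div, abs_mul, abs_pow, abs_of_pos (by positivity : 0 < 2 * k * s ^ 2),
      div_le_div_iff₀ (by positivity) hs]
    calc |k - s ^ 2| ^ 2 * |k - s ^ 2| * s ≤ (C * s) ^ 2 * (C * s) * s := by gcongr
      _ = C ^ 3 * (2 * (s ^ 2 / 2) * s ^ 2) := by ring
      _ ≤ C ^ 3 * (2 * k * s ^ 2) := by gcongr
  rw [e, add_div, add_div]
  exact (abs_add_le _ _).trans (add_le_add ((abs_sub _ _).trans (add_le_add b1 b2)) b3)

lemma tendsto_div_of_abs_sub_le_sqrt {ι : Type*} {l : Filter ι} {ell x : ι → ℝ} {C : ℝ}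
    (hell : Tendsto ell l atTop) (hx : ∀ᶠ i in l, |x i - ell i| ≤ C * sqrt (ell i)) :
    Tendsto (fun i => x i / ell i) l (nhds 1) := by
  have hs : Tendsto (fun i => sqrt (ell i)) l atTop := Real.tendsto_sqrt_atTop.comp hell
  rw [← tendsto_sub_nhds_zero_iff]
  refine squeeze_zero_norm' ?_ (tendsto_const_nhds (x := C).div_atTop hs)
  filter_upwards [hx, hell.eventually_gt_atTop 0] with i hi h0
  have e : x i / ell i - 1 = (x i - ell i) / ell i := by field_simp
  rw [e, norm_div, Real.norm_eq_abs, Real.norm_eq_abs, abs_of_pos h0,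
    div_le_div_iff₀ h0 (Real.sqrt_pos.2 h0)]
  calc |x i - ell i| * sqrt (ell i) ≤ C * sqrt (ell i) * sqrt (ell i) := by gcongr
    _ = C * ell i := by rw [mul_assoc, Real.mul_self_sqrt h0.le]

/-- Normal approximation of the Poisson probabilities in the central range. -/
theorem tendsto_poisson_div_gaussian {ι : Type*} {l : Filter ι} {ell P : ι → ℝ} {k : ι → ℕ}
    {B C : ℝ} (hB : 0 ≤ B) (hC : 1 ≤ C) (hell : Tendsto ell l atTop)
    (hk : ∀ᶠ i in l, |(k i : ℝ) - ell i| ≤ C * sqrt (ell i))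
    (hP : ∀ᶠ i in l, |P i - ell i| ≤ B) :
    Tendsto (fun i => (exp (-P i) * (P i ^ k i / (k i).factorial)) /
      ((1 / sqrt (2 * π * ell i)) * exp (-((k i : ℝ) - ell i) ^ 2 / (2 * ell i)))) l
      (nhds 1) := by
  have hs : Tendsto (fun i => sqrt (ell i)) l atTop := Real.tendsto_sqrt_atTop.comp hell
  have hkell := tendsto_div_of_abs_sub_le_sqrt hell hk
  have hkt : Tendsto k l atTop := by
    have := hkell.pos_mul_atTop one_pos hell
    refine tendsto_natCast_atTop_iff.1 (this.congr' ?_)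
    filter_upwards [hell.eventually_gt_atTop 0] with i hi
    field_simp
  have hst : Tendsto (fun i => ((k i).factorial : ℝ) /
      (sqrt (2 * k i * π) * ((k i : ℝ) / exp 1) ^ k i)) l (nhds 1) := by
    have h := Stirling.factorial_isEquivalent_stirling
    rw [Asymptotics.isEquivalent_iff_tendsto_one] at h
    · exact h.comp hkt
    · filter_upwards [eventually_gt_atTop 0] with n hn
      have : (0 : ℝ) < n := by exact_mod_cast hn
      positivity
  have hE : Tendsto (fun i => exp ((k i : ℝ) - P i + k i * log (P i / k i) +
      ((k i : ℝ) - ell i) ^ 2 / (2 * ell i))) l (nhds 1) := by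
    rw [← Real.exp_zero]
    refine (Real.continuous_exp.tendsto 0).comp (squeeze_zero_norm' ?_
      (tendsto_const_nhds (x := 8 * (C + 1) ^ 3 + 2 * (C + 1) * B + C ^ 3).div_atTop hs))
    filter_upwards [hk, hP, hell.eventually_gt_atTop 0, hs.eventually_ge_atTop B,
      hs.eventually_ge_atTop (4 * (C + 1))] with i h1 h2 h3 h4 h5
    have := Real.sq_sqrt h3.le
    have := poisson_exponent_bound (s := sqrt (ell i)) (k := k i) (P := P i) hB hC h4 h5
      (by rwa [this]) (by rwa [this])
    rwa [Real.sq_sqrt h3.le] at this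
  have hsq := (Real.continuous_sqrt.tendsto 1).comp hkell
  have := (hE.div hst one_ne_zero).div hsq (by simp)
  rw [Real.sqrt_one, div_one, div_one] at this
  refine this.congr' ?_
  have hPt : Tendsto P l atTop := by
    refine tendsto_atTop_mono' l ?_ (tendsto_atTop_add_const_right l (-B) hell)
    filter_upwards [hP] with i hi
    linarith [(abs_le.1 hi).1]
  filter_upwards [hell.eventually_gt_atTop 0, hkt.eventually_gt_atTop 0,
    hPt.eventually_gt_atTop 0] with i h1 h2 h3
  have h2' : (0 : ℝ) < k i := by exact_mod_cast h2
  have e1 : exp ((k i : ℝ) - P i + k i * log (P i / k i) +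
      ((k i : ℝ) - ell i) ^ 2 / (2 * ell i)) =
      exp 1 ^ k i * exp (-P i) * (P i / k i) ^ k i /
        exp (-((k i : ℝ) - ell i) ^ 2 / (2 * ell i)) := by
    have : (P i / k i) ^ k i = exp (k i * log (P i / k i)) := by
      rw [Real.exp_nat_mul, Real.exp_log (by positivity)]
    rw [this, ← Real.exp_nat_mul, ← exp_add, ← exp_add, ← exp_sub]
    ring_nf
  simp only [Pi.div_apply, Function.comp]
  rw [e1, Real.sqrt_div h2'.le, show 2 * (k i : ℝ) * π = 2 * π * k i by ring,
    Real.sqrt_mul (by positivity) (k i : ℝ), Real.sqrt_mul (by positivity) (ell i)]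
  have := Real.sqrt_pos.2 h1
  have := Real.sqrt_pos.2 h2'
  have := Real.sqrt_pos.2 (by positivity : 0 < 2 * π)
  have := exp_pos (-((k i : ℝ) - ell i) ^ 2 / (2 * ell i))
  have : (0 : ℝ) < (k i).factorial := by positivity
  rw [div_pow, div_pow]
  field_simp

lemma exists_abs_primeZeta_sub_log_le : ∃ B : ℝ, 0 ≤ B ∧ ∀ σ : ℝ, 1 < σ →
    |primeZeta σ 1 - log (∑' n : ℕ, (n : ℝ) ^ (-σ))| ≤ B := by
  obtain ⟨M, hM, hfac⟩ := exists_omegaSeries_factor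
  refine ⟨|log (5 * M)|, abs_nonneg _, fun σ hσ => ?_⟩
  obtain ⟨h, h0, hpos, hle, -, hz⟩ := hfac σ hσ
  have hg := (summable_geometric_of_lt_one (by norm_num)
    (by norm_num : (4 / 5 : ℝ) < 1)).mul_left M
  have hs : Summable h := Summable.of_nonneg_of_le hpos hle hg
  have h1 : 1 ≤ ∑' j, h j := by rw [← h0]; exact hs.le_tsum 0 fun j _ => hpos j
  have h2 : ∑' j, h j ≤ 5 * M := by
    refine (hs.tsum_le_tsum hle hg).trans_eq ?_
    rw [tsum_mul_left, tsum_geometric_of_lt_one (by norm_num) (by norm_num)]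
    ring
  rw [hz, Real.log_mul (by positivity) (exp_pos _).ne', Real.log_exp, sub_add_cancel_right, abs_neg,
    abs_of_nonneg (Real.log_nonneg h1)]
  exact (Real.log_le_log (by positivity) h2).trans (le_abs_self _)

section
variable {ι : Type*} {l : Filter ι} {N k : ι → ℕ} {C : ℝ}

lemma tendsto_log_natCast (hN : Tendsto N l atTop) :
    Tendsto (fun i => log (N i)) l atTop :=
  Real.tendsto_log_atTop.comp (tendsto_natCast_atTop_atTop.comp hN)

lemma tendsto_sub_one_mul_zeta (hN : Tendsto N l atTop) {j : ℝ} (hj : 0 < j) :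
    Tendsto (fun i => (j / log (N i)) * ∑' n : ℕ, (n : ℝ) ^ (-(1 + j / log (N i)))) l
      (nhds 1) := by
  have hL := tendsto_log_natCast hN
  have h0 := (tendsto_const_nhds (x := j)).div_atTop hL
  have h1 : Tendsto (fun i => 1 + j / log (N i)) l (nhdsWithin 1 (Set.Ioi 1)) := by
    refine tendsto_nhdsWithin_iff.2 ⟨by simpa using h0.const_add 1, ?_⟩
    filter_upwards [hL.eventually_gt_atTop 0] with i hi
    have : 0 < j / log (N i) := by positivity
    simpa using this
  refine (tendsto_sub_mul_tsum_nat_rpow.comp h1).congr fun i => ?_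
  simp only [Function.comp, add_sub_cancel_left]
  congr 1
  exact tsum_congr fun n => by rw [Real.rpow_neg (by positivity), one_div]

/-- Asymptotics of the Dirichlet series over `Ω = k` at `1 + j / log N`. -/
theorem tendsto_omegaSeries_div_gaussN (hN : Tendsto N l atTop) (hC : 1 ≤ C)
    (hk : ∀ᶠ i in l, |(k i : ℝ) - log (log (N i))| ≤ C * sqrt (log (log (N i))))
    {j : ℝ} (hj : 0 < j) :
    Tendsto (fun i => omegaSeries (1 + j / log (N i)) (k i) /
      (log (N i) / j * gaussN (N i) (k i))) l (nhds 1) := by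
  have hL := tendsto_log_natCast hN
  have hell : Tendsto (fun i => log (log (N i))) l atTop := Real.tendsto_log_atTop.comp hL
  set ell := fun i => log (log (N i)) with hell_def
  set σ := fun i => 1 + j / log (N i) with hσ_def
  set P := fun i => primeZeta (σ i) 1 with hP_def
  have hσ : ∀ᶠ i in l, 1 < σ i := by
    filter_upwards [hL.eventually_gt_atTop 0] with i hi
    have : 0 < j / log (N i) := by positivity
    simpa [hσ_def] using this
  have hz := tendsto_sub_one_mul_zeta hN hj
  obtain ⟨B, hB, hPz⟩ := exists_abs_primeZeta_sub_log_le
  have hPell : ∀ᶠ i in l, |P i - ell i| ≤ B + |log j| + 1 := by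
    have hlz := ((Real.continuousAt_log one_ne_zero).tendsto.comp hz).abs
    rw [Real.log_one, abs_zero] at hlz
    filter_upwards [hσ, hL.eventually_gt_atTop 0,
      hlz.eventually_le_const zero_lt_one, hz.eventually_const_lt zero_lt_one] with i h1 h2 h3 h4
    have h5 := hPz _ h1
    simp only [Function.comp] at h3
    have h6 : 0 < ∑' n : ℕ, (n : ℝ) ^ (-σ i) := (pos_iff_pos_of_mul_pos h4).1 (by positivity)
    rw [Real.log_mul (by positivity) h6.ne', Real.log_div hj.ne' h2.ne'] at h3
    have h7 := neg_abs_le (log j)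
    have h8 := le_abs_self (log j)
    rw [abs_le] at h3 h5 ⊢
    simp only [hP_def, hell_def, σ] at h5 ⊢
    constructor <;> linarith [h3.1, h3.2, h5.1, h5.2]
  have hB' : 0 ≤ B + |log j| + 1 := by positivity
  have hPt : Tendsto P l atTop := by
    refine tendsto_atTop_mono' l ?_ (tendsto_atTop_add_const_right l (-(B + |log j| + 1)) hell)
    filter_upwards [hPell] with i hi
    have := (abs_le.1 hi).1
    simp only [ell] at this ⊢
    linarith
  have hPl : Tendsto (fun i => P i / ell i) l (nhds 1) := by
    refine tendsto_div_of_abs_sub_le_sqrt (C := B + |log j| + 1) hell ?_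
    filter_upwards [hPell, hell.eventually_ge_atTop 1] with i h1 h2
    refine h1.trans (le_mul_of_one_le_right hB' ?_)
    exact Real.one_le_sqrt.2 h2
  have hkP : Tendsto (fun i => (k i : ℝ) / P i) l (nhds 1) := by
    have h := (tendsto_div_of_abs_sub_le_sqrt hell hk).div hPl one_ne_zero
    rw [div_one] at h
    refine h.congr' ?_
    filter_upwards [hell.eventually_gt_atTop 0] with i h1
    simp only [Pi.div_apply]
    have : ell i ≠ 0 := ne_of_gt h1
    field_simp
  have hfin := ((tendsto_omegaSeries_ratio hσ hPt hkP).mul hz).mul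
    (tendsto_poisson_div_gaussian hB' hC hell hk hPell)
  rw [one_mul, one_mul] at hfin
  refine hfin.congr' ?_
  filter_upwards [hL.eventually_gt_atTop 0, hPt.eventually_gt_atTop 0,
    hz.eventually_const_lt zero_lt_one] with i h1 h2 h3
  have h6 : 0 < ∑' n : ℕ, (n : ℝ) ^ (-σ i) := (pos_iff_pos_of_mul_pos h3).1 (by positivity)
  have h7 : 0 < exp (-P i) * (P i ^ k i / (k i).factorial) := by
    have : 0 < P i := h2
    positivity
  simp only [hP_def] at h7
  rw [gaussN]
  simp only [hP_def, hell_def]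
  generalize exp (-primeZeta (σ i) 1) * (primeZeta (σ i) 1 ^ k i / (k i).factorial) = q at *
  change 0 < j / log (N i) * ∑' n : ℕ, (n : ℝ) ^ (-σ i) at h3
  change omegaSeries (σ i) (k i) / ((∑' n : ℕ, (n : ℝ) ^ (-σ i)) * q) *
    (j / log (N i) * ∑' n : ℕ, (n : ℝ) ^ (-σ i)) * _ = omegaSeries (σ i) (k i) / _
  generalize ∑' n : ℕ, (n : ℝ) ^ (-σ i) = Z at *
  field_simp
end

section
variable {ι : Type*} {l : Filter ι} {w u : ι → ℕ → ℝ}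

lemma summable_mul_of_abs_le {w g : ℕ → ℝ} {K : ℝ} (hw0 : ∀ n, 0 ≤ w n) (hw : Summable w)
    (hg : ∀ n, |g n| ≤ K) : Summable fun n => w n * g n := by
  refine Summable.of_norm_bounded (hw.mul_right K) fun n => ?_
  rw [norm_mul, Real.norm_eq_abs, Real.norm_eq_abs, abs_of_nonneg (hw0 n)]
  exact mul_le_mul_of_nonneg_left (hg n) (hw0 n)

lemma summable_mul_continuous {w u : ℕ → ℝ} (hw0 : ∀ n, 0 ≤ w n) (hw : Summable w)
    (hu : ∀ n, u n ∈ Set.Icc (0 : ℝ) 1) {f : ℝ → ℝ} (hf : Continuous f) :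
    Summable fun n => w n * f (u n) := by
  obtain ⟨K, hK⟩ := isCompact_Icc.exists_bound_of_continuousOn (s := Set.Icc (0 : ℝ) 1)
    hf.continuousOn
  exact summable_mul_of_abs_le hw0 hw fun n => hK _ (hu n)

/-- Convergence of moments to those of Lebesgue measure on `[0, 1]` implies convergence against
continuous functions. -/
theorem tendsto_tsum_mul_continuous (hw0 : ∀ᶠ i in l, ∀ n, 0 ≤ w i n)
    (hw : ∀ᶠ i in l, Summable (w i)) (hu : ∀ᶠ i in l, ∀ n, u i n ∈ Set.Icc (0 : ℝ) 1)
    (hmom : ∀ j : ℕ, Tendsto (fun i => ∑' n, w i n * u i n ^ j) l (nhds (1 / (j + 1))))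
    {f : ℝ → ℝ} (hf : Continuous f) :
    Tendsto (fun i => ∑' n, w i n * f (u i n)) l (nhds (∫ x in (0 : ℝ)..1, f x)) := by
  have hpoly (p : Polynomial ℝ) : Tendsto (fun i => ∑' n, w i n * p.eval (u i n)) l
      (nhds (∫ x in (0 : ℝ)..1, p.eval x)) := by
    induction p using Polynomial.induction_on' with
    | add p q hp hq =>
      simp only [Polynomial.eval_add]
      rw [intervalIntegral.integral_add (p.continuous.intervalIntegrable _ _)
        (q.continuous.intervalIntegrable _ _)]
      refine (hp.add hq).congr' ?_
      filter_upwards [hw0, hw, hu] with i h1 h2 h3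
      rw [← (summable_mul_continuous h1 h2 h3 p.continuous).tsum_add
        (summable_mul_continuous h1 h2 h3 q.continuous)]
      exact tsum_congr fun n => by ring
    | monomial j a =>
      simp only [Polynomial.eval_monomial]
      rw [intervalIntegral.integral_const_mul, integral_pow]
      have := (hmom j).const_mul a
      simp only [one_pow, ne_eq, Nat.add_eq_zero_iff, one_ne_zero, and_false, not_false_eq_true,
        zero_pow, sub_zero]
      refine this.congr fun i => ?_
      rw [← tsum_mul_left]
      exact tsum_congr fun n => by ring
  rw [Metric.tendsto_nhds]
  intro ε hε
  obtain ⟨p, hp⟩ := exists_polynomial_near_of_continuousOn 0 1 f hf.continuousOn (ε / 4)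
    (by positivity)
  have hmass := hmom 0
  simp only [pow_zero, mul_one, CharP.cast_eq_zero, zero_add, div_one] at hmass
  filter_upwards [hw0, hw, hu, (Metric.tendsto_nhds.1 (hpoly p)) (ε / 4) (by positivity),
    hmass.eventually_lt_const (by norm_num : (1 : ℝ) < 2)] with i h1 h2 h3 h4 h5
  have hfs := summable_mul_continuous h1 h2 h3 hf
  have hps := summable_mul_continuous h1 h2 h3 p.continuous
  have hd1 : |∑' n, w i n * f (u i n) - ∑' n, w i n * p.eval (u i n)| ≤ ε / 4 * ∑' n, w i n := by
    rw [← hfs.tsum_sub hps, ← tsum_mul_left, ← Real.norm_eq_abs]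
    refine tsum_of_norm_bounded (h2.mul_left _).hasSum fun n => ?_
    rw [← mul_sub, norm_mul, Real.norm_eq_abs, Real.norm_eq_abs, abs_of_nonneg (h1 n), mul_comm,
      abs_sub_comm]
    exact mul_le_mul_of_nonneg_right (hp _ (h3 n)).le (h1 n)
  have hd2 : |(∫ x in (0 : ℝ)..1, p.eval x) - ∫ x in (0 : ℝ)..1, f x| ≤ ε / 4 := by
    rw [← intervalIntegral.integral_sub (p.continuous.intervalIntegrable _ _)
      (hf.intervalIntegrable _ _), ← Real.norm_eq_abs]
    refine (intervalIntegral.norm_integral_le_of_norm_le_const (C := ε / 4) fun x hx => ?_).trans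
      (by simp)
    rw [Set.uIoc_of_le zero_le_one] at hx
    exact (hp x ⟨hx.1.le, hx.2⟩).le
  rw [Real.dist_eq] at h4 ⊢
  have h6 : ε / 4 * ∑' n, w i n ≤ ε / 2 := by nlinarith
  calc _ = |(∑' n, w i n * f (u i n) - ∑' n, w i n * p.eval (u i n)) +
        ((∑' n, w i n * p.eval (u i n) - ∫ x in (0 : ℝ)..1, p.eval x) +
        ((∫ x in (0 : ℝ)..1, p.eval x) - ∫ x in (0 : ℝ)..1, f x))| := by ring_nf
    _ ≤ _ + (_ + _) := (abs_add_le _ _).trans (add_le_add_right (abs_add_le _ _) _)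
    _ < ε := by linarith

end

/-- The function `1 / x` on `[e⁻¹, ∞)`, extended continuously by `e` to the left. -/
noncomputable def truncInv (x : ℝ) : ℝ := (max x (exp (-1)))⁻¹

/-- The continuous piecewise linear function rising from `0` to `1` on `[a, a + δ]`. -/
noncomputable def ramp (a δ x : ℝ) : ℝ := min 1 (max 0 ((x - a) / δ))

lemma continuous_truncInv : Continuous truncInv :=
  (continuous_id.max continuous_const).inv₀ fun _ => (lt_max_of_lt_right (exp_pos _)).ne'

lemma truncInv_nonneg (x : ℝ) : 0 ≤ truncInv x :=
  inv_nonneg.2 (le_max_of_le_right (exp_pos _).le)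

lemma truncInv_le (x : ℝ) : truncInv x ≤ exp 1 := by
  rw [truncInv, ← inv_inv (exp 1), ← Real.exp_neg]
  exact inv_anti₀ (exp_pos _) (le_max_right _ _)

lemma truncInv_of_le {x : ℝ} (hx : exp (-1) ≤ x) : truncInv x = x⁻¹ := by
  rw [truncInv, max_eq_left hx]

lemma continuous_ramp (a δ : ℝ) : Continuous (ramp a δ) := by
  unfold ramp; fun_prop

lemma ramp_nonneg (a δ x : ℝ) : 0 ≤ ramp a δ x := le_min zero_le_one (le_max_left _ _)

lemma ramp_le_one (a δ x : ℝ) : ramp a δ x ≤ 1 := min_le_left _ _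

lemma ramp_of_le {a δ x : ℝ} (hδ : 0 < δ) (hx : x ≤ a) : ramp a δ x = 0 := by
  rw [ramp, max_eq_left (div_nonpos_of_nonpos_of_nonneg (by linarith) hδ.le)]
  exact min_eq_right zero_le_one

lemma ramp_of_ge {a δ x : ℝ} (hδ : 0 < δ) (hx : a + δ ≤ x) : ramp a δ x = 1 := by
  have : 1 ≤ (x - a) / δ := by rw [le_div_iff₀ hδ]; linarith
  rw [ramp, max_eq_right (by linarith)]
  exact min_eq_left this

lemma integral_inv_exp_neg_one : ∫ x in exp (-1)..1, x⁻¹ = 1 := by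
  rw [integral_inv_of_pos (exp_pos _) one_pos, one_div, ← Real.exp_neg, Real.log_exp, neg_neg]

lemma integral_lower_ramp {δ : ℝ} (hδ : 0 < δ) (hδ2 : δ ≤ 1 / 4) :
    1 - exp 1 * δ ≤ ∫ x in (0 : ℝ)..1, truncInv x * ramp (exp (-1)) δ x := by
  set f := fun x => truncInv x * ramp (exp (-1)) δ x with hf
  have hc : Continuous f := continuous_truncInv.mul (continuous_ramp _ _)
  have hnn (x : ℝ) : 0 ≤ f x := mul_nonneg (truncInv_nonneg _) (ramp_nonneg _ _ _)
  have he := exp_pos (-1)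
  have he2 := Real.exp_neg_one_lt_half
  rw [← intervalIntegral.integral_add_adjacent_intervals (hc.intervalIntegrable 0 (exp (-1) + δ))
    (hc.intervalIntegrable (exp (-1) + δ) 1)]
  have h1 : 0 ≤ ∫ x in (0 : ℝ)..(exp (-1) + δ), f x :=
    intervalIntegral.integral_nonneg (by positivity) fun x _ => hnn x
  have h2 : ∫ x in (exp (-1) + δ)..1, f x = ∫ x in (exp (-1) + δ)..1, x⁻¹ := by
    refine intervalIntegral.integral_congr fun x hx => ?_
    rw [Set.uIcc_of_le (by linarith)] at hx
    simp only [hf]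
    rw [ramp_of_ge hδ hx.1, truncInv_of_le (by linarith [hx.1]), mul_one]
  rw [h2, integral_inv_of_pos (by positivity) one_pos, one_div, Real.log_inv]
  have h3 : log (exp (-1) + δ) = -1 + log (1 + exp 1 * δ) := by
    have : exp (-1) + δ = exp (-1) * (1 + exp 1 * δ) := by
      rw [mul_add, ← mul_assoc, ← exp_add]; simp
    rw [this, Real.log_mul he.ne' (by positivity), Real.log_exp]
  have h4 := Real.log_le_sub_one_of_pos (by positivity : 0 < 1 + exp 1 * δ)
  linarith

lemma integral_upper_ramp {δ : ℝ} (hδ : 0 < δ) (hδ2 : δ ≤ exp (-1)) :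
    ∫ x in (0 : ℝ)..1, truncInv x * ramp (exp (-1) - δ) δ x ≤ 1 + exp 1 * δ := by
  set f := fun x => truncInv x * ramp (exp (-1) - δ) δ x with hf
  have hc : Continuous f := continuous_truncInv.mul (continuous_ramp _ _)
  have he := exp_pos (-1)
  have he2 := Real.exp_neg_one_lt_half
  rw [← intervalIntegral.integral_add_adjacent_intervals (hc.intervalIntegrable 0 (exp (-1)))
    (hc.intervalIntegrable (exp (-1)) 1), ← intervalIntegral.integral_add_adjacent_intervals
    (hc.intervalIntegrable 0 (exp (-1) - δ)) (hc.intervalIntegrable (exp (-1) - δ) (exp (-1)))]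
  have h1 : ∫ x in (0 : ℝ)..(exp (-1) - δ), f x = 0 := by
    rw [intervalIntegral.integral_congr (g := fun _ => (0 : ℝ))]
    · simp
    · intro x hx
      rw [Set.uIcc_of_le (by linarith)] at hx
      simp only [hf]
      rw [ramp_of_le hδ hx.2, mul_zero]
  have h2 : ∫ x in (exp (-1))..1, f x = 1 := by
    refine (intervalIntegral.integral_congr fun x hx => ?_).trans integral_inv_exp_neg_one
    rw [Set.uIcc_of_le (by linarith)] at hx
    simp only [hf]
    rw [ramp_of_ge hδ (by linarith [hx.1]), truncInv_of_le hx.1, mul_one]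
  have h3 : ∫ x in (exp (-1) - δ)..(exp (-1)), f x ≤ exp 1 * δ := by
    refine (Real.le_norm_self _).trans ((intervalIntegral.norm_integral_le_of_norm_le_const
      (C := exp 1) fun x _ => ?_).trans_eq ?_)
    · rw [Real.norm_eq_abs, abs_of_nonneg (mul_nonneg (truncInv_nonneg _) (ramp_nonneg _ _ _))]
      exact (mul_le_of_le_one_right (truncInv_nonneg _) (ramp_le_one _ _ _)).trans (truncInv_le x)
    · rw [sub_sub_cancel, abs_of_pos hδ]
  linarith

/-- Karamata's Tauberian argument, for families of discrete measures on `[0, 1]` whose moments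
converge to those of Lebesgue measure. -/
theorem tendsto_tsum_mul_ite_inv {ι : Type*} {l : Filter ι} {w u : ι → ℕ → ℝ}
    (hw0 : ∀ᶠ i in l, ∀ n, 0 ≤ w i n)
    (hw : ∀ᶠ i in l, Summable (w i)) (hu : ∀ᶠ i in l, ∀ n, u i n ∈ Set.Icc (0 : ℝ) 1)
    (hmom : ∀ j : ℕ, Tendsto (fun i => ∑' n, w i n * u i n ^ j) l (nhds (1 / (j + 1)))) :
    Tendsto (fun i => ∑' n, w i n * if exp (-1) ≤ u i n then (u i n)⁻¹ else 0) l (nhds 1) := by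
  rw [Metric.tendsto_nhds]
  intro ε hε
  set δ := min (exp (-1) / 2) (ε / (2 * exp 1)) with hδdef
  have he := exp_pos (-1)
  have he1 := exp_pos 1
  have he2 := Real.exp_neg_one_lt_half
  have hδ : 0 < δ := lt_min (by positivity) (by positivity)
  have hδ1 : δ ≤ exp (-1) / 2 := min_le_left _ _
  have hδ2 : exp 1 * δ ≤ ε / 2 := by
    calc exp 1 * δ ≤ exp 1 * (ε / (2 * exp 1)) := by gcongr; exact min_le_right _ _
      _ = ε / 2 := by field_simp
  set f₁ := fun x => truncInv x * ramp (exp (-1)) δ x with hf₁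
  set f₂ := fun x => truncInv x * ramp (exp (-1) - δ) δ x with hf₂
  have hc₁ : Continuous f₁ := continuous_truncInv.mul (continuous_ramp _ _)
  have hc₂ : Continuous f₂ := continuous_truncInv.mul (continuous_ramp _ _)
  have t₁ := tendsto_tsum_mul_continuous hw0 hw hu hmom hc₁
  have t₂ := tendsto_tsum_mul_continuous hw0 hw hu hmom hc₂
  have i₁ := integral_lower_ramp hδ (by linarith)
  have i₂ := integral_upper_ramp hδ (by linarith)
  have hle₁ (x : ℝ) : f₁ x ≤ if exp (-1) ≤ x then x⁻¹ else 0 := by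
    simp only [hf₁]
    split_ifs with h
    · rw [← truncInv_of_le h]
      exact mul_le_of_le_one_right (truncInv_nonneg _) (ramp_le_one _ _ _)
    · rw [ramp_of_le hδ (by linarith), mul_zero]
  have hle₂ (x : ℝ) : (if exp (-1) ≤ x then x⁻¹ else 0) ≤ f₂ x := by
    simp only [hf₂]
    split_ifs with h
    · rw [← truncInv_of_le h, ramp_of_ge hδ (by linarith), mul_one]
    · exact mul_nonneg (truncInv_nonneg _) (ramp_nonneg _ _ _)
  filter_upwards [hw0, hw, hu, t₁.eventually_const_lt
    (by linarith : 1 - ε < ∫ x in (0 : ℝ)..1, f₁ x), t₂.eventually_lt_const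
    (by linarith : ∫ x in (0 : ℝ)..1, f₂ x < 1 + ε)] with i h1 h2 h3 h4 h5
  have s : Summable fun n => w i n * if exp (-1) ≤ u i n then (u i n)⁻¹ else 0 := by
    refine summable_mul_of_abs_le (K := exp 1) h1 h2 fun n => ?_
    split_ifs with h
    · rw [← truncInv_of_le h, abs_of_nonneg (truncInv_nonneg _)]
      exact truncInv_le _
    · rw [abs_zero]; positivity
  have l₁ := (summable_mul_continuous h1 h2 h3 hc₁).tsum_le_tsum
    (fun n => mul_le_mul_of_nonneg_left (hle₁ (u i n)) (h1 n)) s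
  have l₂ := s.tsum_le_tsum (fun n => mul_le_mul_of_nonneg_left (hle₂ (u i n)) (h1 n))
    (summable_mul_continuous h1 h2 h3 hc₂)
  rw [Real.dist_eq, abs_lt]
  constructor <;> linarith

lemma gaussN_pos {N : ℕ} (hN : 0 < log (log N)) (k : ℕ) : 0 < gaussN N k := by
  unfold gaussN; positivity

/-- The sum of `1 / n` over `n ≤ N` with exactly `k` prime factors. -/
noncomputable def omegaHarmonic (N k : ℕ) : ℝ :=
  ∑ n ∈ (Icc 1 N).filter (fun n => bigOmega n = k), (n : ℝ)⁻¹

section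
variable {ι : Type*} {l : Filter ι} {N k : ι → ℕ} {C : ℝ}

theorem tendsto_omegaHarmonic_div (hN : Tendsto N l atTop) (hC : 1 ≤ C)
    (hk : ∀ᶠ i in l, |(k i : ℝ) - log (log (N i))| ≤ C * sqrt (log (log (N i)))) :
    Tendsto (fun i => omegaHarmonic (N i) (k i) / (log (N i) * gaussN (N i) (k i))) l
      (nhds 1) := by
  have hL := tendsto_log_natCast hN
  have hell : Tendsto (fun i => log (log (N i))) l atTop := Real.tendsto_log_atTop.comp hL
  set G := fun i => log (N i) * gaussN (N i) (k i) with hG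
  have hGpos : ∀ᶠ i in l, 0 < G i := by
    filter_upwards [hL.eventually_gt_atTop 0, hell.eventually_gt_atTop 0] with i h1 h2
    exact mul_pos h1 (gaussN_pos h2 _)
  set w : ι → ℕ → ℝ := fun i n =>
    (if bigOmega n = k i then (n : ℝ) ^ (-(1 + 1 / log (N i))) else 0) / G i with hw
  set u : ι → ℕ → ℝ := fun i n => (n : ℝ) ^ (-(1 / log (N i))) with hu
  have hw0 : ∀ᶠ i in l, ∀ n, 0 ≤ w i n := by
    filter_upwards [hGpos] with i h1 n
    simp only [hw]
    split_ifs <;> positivity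
  have hws : ∀ᶠ i in l, Summable (w i) := by
    filter_upwards [hL.eventually_gt_atTop 0] with i h1
    exact (summable_ite_rpow (by linarith [one_div_pos.2 h1]) _).div_const _
  have hu1 : ∀ᶠ i in l, ∀ n, u i n ∈ Set.Icc (0 : ℝ) 1 := by
    filter_upwards [hL.eventually_gt_atTop 0] with i h1 n
    have h2 := one_div_pos.2 h1
    refine ⟨Real.rpow_nonneg (Nat.cast_nonneg _) _, ?_⟩
    simp only [hu]
    rcases Nat.eq_zero_or_pos n with rfl | hn
    · rw [Nat.cast_zero, Real.zero_rpow (by linarith)]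
      exact zero_le_one
    · exact Real.rpow_le_one_of_one_le_of_nonpos (by exact_mod_cast hn) (by linarith)
  have hmom (j : ℕ) : Tendsto (fun i => ∑' n, w i n * u i n ^ j) l (nhds (1 / (j + 1))) := by
    have h := (tendsto_omegaSeries_div_gaussN hN hC hk
      (by positivity : (0 : ℝ) < j + 1)).const_mul (1 / ((j : ℝ) + 1))
    rw [mul_one] at h
    refine h.congr' ?_
    filter_upwards [hL.eventually_gt_atTop 0, hGpos] with i h1 h2
    have e : ∑' n, w i n * u i n ^ j =
        omegaSeries (1 + ((j : ℝ) + 1) / log (N i)) (k i) / G i := by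
      rw [omegaSeries, ← tsum_div_const]
      refine tsum_congr fun n => ?_
      simp only [hw, hu]
      split_ifs
      · rw [← Real.rpow_natCast, ← Real.rpow_mul (Nat.cast_nonneg _), div_mul_eq_mul_div]
        rcases Nat.eq_zero_or_pos n with rfl | hn
        · rw [Nat.cast_zero, Real.zero_rpow (by linarith [one_div_pos.2 h1]), zero_mul,
            Real.zero_rpow (by
              have : 0 < ((j : ℝ) + 1) / log (N i) := by positivity
              linarith)]
        · rw [← Real.rpow_add (by exact_mod_cast hn)]
          congr 2
          field_simp
          ring
      · simp
    rw [e]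
    have h3 : log (N i) / ((j : ℝ) + 1) * gaussN (N i) (k i) = G i / (j + 1) := by
      simp only [hG]; ring
    rw [h3]
    field_simp
  refine (tendsto_tsum_mul_ite_inv hw0 hws hu1 hmom).congr' ?_
  filter_upwards [hL.eventually_gt_atTop 0, hN.eventually_gt_atTop 0, hGpos] with i h1 h2 h3
  have hN0 : (0 : ℝ) < N i := by exact_mod_cast h2
  have hcond {n : ℕ} (hn : 0 < n) : exp (-1) ≤ u i n ↔ n ≤ N i := by
    have hn' : (0 : ℝ) < n := by exact_mod_cast hn
    simp only [hu]
    rw [Real.rpow_def_of_pos hn', Real.exp_le_exp, ← Nat.cast_le (α := ℝ),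
      ← Real.log_le_log_iff hn' hN0, mul_neg, neg_le_neg_iff, mul_one_div, div_le_one h1]
  have hzero : u i 0 = 0 := by
    simp only [hu]
    rw [Nat.cast_zero, Real.zero_rpow (by linarith [one_div_pos.2 h1])]
  change _ = omegaHarmonic (N i) (k i) / G i
  rw [tsum_eq_sum (s := (Icc 1 (N i)).filter (fun n => bigOmega n = k i)), omegaHarmonic, sum_div]
  · refine sum_congr rfl fun n hn => ?_
    rw [mem_filter, mem_Icc] at hn
    have hn' : (0 : ℝ) < n := by exact_mod_cast hn.1.1
    rw [if_pos ((hcond hn.1.1).2 hn.1.2)]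
    simp only [hw, hu]
    rw [if_pos hn.2, neg_add, Real.rpow_add hn', Real.rpow_neg_one]
    have : (0 : ℝ) < (n : ℝ) ^ (-(1 / log (N i))) := by positivity
    field_simp
  · intro n hn
    rw [mem_filter, mem_Icc, not_and_or] at hn
    rcases Nat.eq_zero_or_pos n with rfl | h0
    · rw [hzero, inv_zero, ite_self, mul_zero]
    · rcases hn with h | h
      · rw [if_neg, mul_zero]
        rw [hcond h0]
        omega
      · simp only [hw]
        rw [if_neg h, zero_div, zero_mul]

lemma tendsto_log_mul_gaussN (hN : Tendsto N l atTop)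
    (hk : ∀ᶠ i in l, |(k i : ℝ) - log (log (N i))| ≤ C * sqrt (log (log (N i)))) :
    Tendsto (fun i => log (N i) * gaussN (N i) (k i)) l atTop := by
  have hL := tendsto_log_natCast hN
  have hell : Tendsto (fun i => log (log (N i))) l atTop := Real.tendsto_log_atTop.comp hL
  have hc : 0 < exp (-(C ^ 2) / 2) / (4 * π) := by positivity
  refine tendsto_atTop_mono' l ?_ (hell.const_mul_atTop hc)
  filter_upwards [hell.eventually_ge_atTop 1, hL.eventually_gt_atTop 0, hk] with i h1 h2 h3
  set ell := log (log (N i)) with hell_def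
  have h4 : ell ^ 2 / 2 ≤ log (N i) := by
    rw [← Real.exp_log h2]
    exact (by linarith : ell ^ 2 / 2 ≤ 1 + ell + ell ^ 2 / 2).trans
      (Real.quadratic_le_exp_of_nonneg (by linarith))
  have h5 : sqrt (2 * π * ell) ≤ 2 * π * ell := by
    refine Real.sqrt_le_iff.2 ⟨by positivity, ?_⟩
    have : 1 ≤ 2 * π * ell := by nlinarith [Real.pi_gt_three]
    nlinarith
  have h6 : exp (-(C ^ 2) / 2) ≤ exp (-((k i : ℝ) - ell) ^ 2 / (2 * ell)) := by
    rw [Real.exp_le_exp, div_le_div_iff₀ (by norm_num) (by linarith)]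
    have h7 : ((k i : ℝ) - ell) ^ 2 ≤ C ^ 2 * ell := by
      rw [← Real.sq_sqrt (by linarith : 0 ≤ ell), ← mul_pow]
      rw [Real.sq_sqrt (by linarith : 0 ≤ ell)]
      exact sq_le_sq' (by linarith [(abs_le.1 h3).1]) (abs_le.1 h3).2
    linarith
  have h8 : 0 < sqrt (2 * π * ell) := Real.sqrt_pos.2 (by positivity)
  calc exp (-(C ^ 2) / 2) / (4 * π) * ell
      = ell ^ 2 / 2 * (1 / (2 * π * ell) * exp (-(C ^ 2) / 2)) := by field_simp; ring
    _ ≤ log (N i) * (1 / sqrt (2 * π * ell) * exp (-((k i : ℝ) - ell) ^ 2 / (2 * ell))) := by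
      gcongr
    _ = _ := by rw [gaussN]

lemma tendsto_gaussN_pred_div (hN : Tendsto N l atTop) (hk1 : ∀ᶠ i in l, 1 ≤ k i)
    (hk : ∀ᶠ i in l, |(k i : ℝ) - log (log (N i))| ≤ C * sqrt (log (log (N i)))) :
    Tendsto (fun i => gaussN (N i) (k i - 1) / gaussN (N i) (k i)) l (nhds 1) := by
  have hL := tendsto_log_natCast hN
  have hell : Tendsto (fun i => log (log (N i))) l atTop := Real.tendsto_log_atTop.comp hL
  have h1 := (tendsto_div_of_abs_sub_le_sqrt hell hk).sub_const 1
  have h2 := h1.sub ((tendsto_const_nhds (x := (1 : ℝ) / 2)).div_atTop hell)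
  rw [sub_self, sub_zero] at h2
  have h3 := (Real.continuous_exp.tendsto 0).comp h2
  rw [Real.exp_zero] at h3
  refine h3.congr' ?_
  filter_upwards [hell.eventually_gt_atTop 0, hk1] with i h4 h5
  simp only [Function.comp, gaussN]
  rw [mul_div_mul_left _ _ (by positivity), ← exp_sub, Nat.cast_sub h5]
  congr 1
  field_simp
  push_cast
  ring

end

/-- The arithmetic function equal to `log p` at primes `p` and to zero elsewhere. -/
noncomputable def primeLog : ArithmeticFunction ℝ :=
  ⟨fun n => if n.Prime then log n else 0, by simp⟩

/-- The von Mangoldt function restricted to proper prime powers. -/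
noncomputable def properPowerLog : ArithmeticFunction ℝ :=
  ⟨fun n => if n.Prime then 0 else ArithmeticFunction.vonMangoldt n, by simp⟩

/-- The indicator function of the positive integers with exactly `k` prime factors. -/
noncomputable def omegaIndicator (k : ℕ) : ArithmeticFunction ℝ :=
  ⟨fun n => if n ≠ 0 ∧ bigOmega n = k then 1 else 0, by simp⟩

theorem primeLog_apply (n : ℕ) : primeLog n = if n.Prime then log n else 0 := rfl

theorem properPowerLog_apply (n : ℕ) :
    properPowerLog n = if n.Prime then 0 else ArithmeticFunction.vonMangoldt n := rfl

theorem omegaIndicator_apply (k n : ℕ) :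
    omegaIndicator k n = if n ≠ 0 ∧ bigOmega n = k then 1 else 0 := rfl

theorem properPowerLog_nonneg (n : ℕ) : 0 ≤ properPowerLog n := by
  rw [properPowerLog_apply]
  split_ifs
  · rfl
  · exact ArithmeticFunction.vonMangoldt_nonneg

theorem primeLog_add_properPowerLog :
    primeLog + properPowerLog = ArithmeticFunction.vonMangoldt := by
  ext n
  rw [ArithmeticFunction.add_apply, primeLog_apply, properPowerLog_apply]
  split_ifs with h
  · rw [ArithmeticFunction.vonMangoldt_apply_prime h, add_zero]
  · rw [zero_add]

theorem bigOmega_prime {p : ℕ} (hp : p.Prime) : bigOmega p = 1 := by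
  simpa using bigOmega_prime_pow hp 1

theorem omegaIndicator_mul_primeLog {n : ℕ} (hn : n ≠ 0) (k : ℕ) :
    (omegaIndicator k * primeLog) n =
      if bigOmega n = k + 1 then (ArithmeticFunction.zeta * primeLog) n else 0 := by
  rw [ArithmeticFunction.mul_apply, ArithmeticFunction.mul_apply]
  trans ∑ x ∈ n.divisorsAntidiagonal, if bigOmega n = k + 1 then
    (ArithmeticFunction.zeta : ArithmeticFunction ℝ) x.1 * primeLog x.2 else 0
  swap
  · split_ifs <;> simp
  refine Finset.sum_congr rfl fun x hx => ?_
  obtain ⟨hx, -⟩ := Nat.mem_divisorsAntidiagonal.1 hx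
  have h1 : x.1 ≠ 0 := by rintro h; simp [h] at hx; omega
  have h2 : x.2 ≠ 0 := by rintro h; simp [h] at hx; omega
  rw [primeLog_apply, omegaIndicator_apply]
  by_cases hp : x.2.Prime
  · rw [← hx, bigOmega_mul h1 h2, bigOmega_prime hp]
    simp [h1, hp]
  · simp [hp]

theorem sum_log_eq (N k : ℕ) :
    ∑ n ∈ (Icc 1 N).filter (fun n => bigOmega n = k + 1), log n =
      ∑ m ∈ (Icc 1 N).filter (fun m => bigOmega m = k), Chebyshev.theta ((N : ℝ) / m) +
      ∑ n ∈ (Icc 1 N).filter (fun n => bigOmega n = k + 1),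
        (properPowerLog * ArithmeticFunction.zeta) n := by
  have h1 : ∀ m, ∑ p ∈ Ioc 0 (N / m), primeLog p = Chebyshev.theta ((N : ℝ) / m) := by
    intro m
    rw [Chebyshev.theta, Nat.floor_div_eq_div, Finset.sum_filter]
    rfl
  have h2 := ArithmeticFunction.sum_Ioc_mul_eq_sum_sum (omegaIndicator k) primeLog N
  have hI : Ioc 0 N = Icc 1 N := rfl
  simp only [h1] at h2
  rw [hI] at h2
  have h3 : ∑ n ∈ Icc 1 N, (omegaIndicator k * primeLog) n =
      ∑ n ∈ (Icc 1 N).filter (fun n => bigOmega n = k + 1),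
        (ArithmeticFunction.zeta * primeLog) n := by
    rw [Finset.sum_filter]
    refine Finset.sum_congr rfl fun n hn => omegaIndicator_mul_primeLog ?_ k
    have := (Finset.mem_Icc.1 hn).1
    omega
  have h4 : ∑ m ∈ Icc 1 N, omegaIndicator k m * Chebyshev.theta ((N : ℝ) / m) =
      ∑ m ∈ (Icc 1 N).filter (fun m => bigOmega m = k), Chebyshev.theta ((N : ℝ) / m) := by
    rw [Finset.sum_filter]
    refine Finset.sum_congr rfl fun n hn => ?_
    have : n ≠ 0 := by have := (Finset.mem_Icc.1 hn).1; omega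
    simp [omegaIndicator_apply, this]
  rw [← h4, ← h2, h3, ← Finset.sum_add_distrib]
  refine Finset.sum_congr rfl fun n _ => ?_
  rw [← ArithmeticFunction.log_apply, ← ArithmeticFunction.vonMangoldt_mul_zeta,
    ← primeLog_add_properPowerLog, add_mul, mul_comm primeLog, ArithmeticFunction.add_apply]

theorem summable_properPowerLog_div : Summable fun n : ℕ => properPowerLog n / n := by
  convert! ArithmeticFunction.vonMangoldt.summable_residueClass_non_primes_div (0 : ZMod 1) using 3
  rw [properPowerLog_apply, ArithmeticFunction.vonMangoldt.residueClass, Set.indicator_of_mem]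
  exact Subsingleton.elim _ _

theorem properPowerLog_mul_zeta_nonneg (n : ℕ) :
    0 ≤ (properPowerLog * ArithmeticFunction.zeta) n := by
  rw [ArithmeticFunction.mul_apply]
  refine Finset.sum_nonneg fun x _ => mul_nonneg (properPowerLog_nonneg _) ?_
  rw [ArithmeticFunction.natCoe_apply]
  positivity

theorem sum_properPowerLog_mul_zeta_le (N : ℕ) :
    ∑ n ∈ Icc 1 N, (properPowerLog * ArithmeticFunction.zeta) n ≤
      (∑' n : ℕ, properPowerLog n / n) * N := by
  have h := ArithmeticFunction.sum_Ioc_mul_zeta_eq_sum properPowerLog N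
  have hI : Ioc 0 N = Icc 1 N := rfl
  rw [hI] at h
  rw [h]
  calc ∑ n ∈ Icc 1 N, properPowerLog n * ((N / n : ℕ) : ℝ)
      ≤ ∑ n ∈ Icc 1 N, properPowerLog n / n * N := by
        refine Finset.sum_le_sum fun n _ => ?_
        calc _ ≤ properPowerLog n * ((N : ℝ) / n) :=
              mul_le_mul_of_nonneg_left Nat.cast_div_le (properPowerLog_nonneg n)
          _ = _ := by ring
    _ = (∑ n ∈ Icc 1 N, properPowerLog n / n) * N := by rw [Finset.sum_mul]
    _ ≤ _ := by
        gcongr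
        exact summable_properPowerLog_div.sum_le_tsum _ fun n _ =>
          div_nonneg (properPowerLog_nonneg n) n.cast_nonneg

theorem sum_log_natCast (N : ℕ) : ∑ n ∈ Icc 1 N, log n = log (N.factorial) := by
  induction N with
  | zero => simp
  | succ N ih =>
    rw [Finset.sum_Icc_succ_top (by omega), ih, Nat.factorial_succ, Nat.cast_mul,
      Real.log_mul (by positivity) (by positivity), add_comm]

theorem sum_log_div_le (N : ℕ) : ∑ n ∈ Icc 1 N, (log N - log n) ≤ N := by
  rcases N.eq_zero_or_pos with rfl | hN
  · simp
  have hN' : (0 : ℝ) < N := by exact_mod_cast hN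
  have hf : (0 : ℝ) < N.factorial := by exact_mod_cast N.factorial_pos
  have h := Real.log_le_log (by positivity) (Real.pow_div_factorial_le_exp _ N.cast_nonneg N)
  rw [Real.log_exp, Real.log_div (by positivity) hf.ne', Real.log_pow] at h
  rw [Finset.sum_sub_distrib, sum_log_natCast]
  simpa using h

theorem abs_piOmega_mul_log_sub_le (N k : ℕ) :
    |(piOmega N k : ℝ) * log N - ∑ n ∈ (Icc 1 N).filter (fun n => bigOmega n = k), log n| ≤ N := by
  have hnn : ∀ n ∈ Icc 1 N, 0 ≤ log N - log n := by
    intro n hn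
    obtain ⟨h1, h2⟩ := Finset.mem_Icc.1 hn
    exact sub_nonneg.2 (Real.log_le_log (by exact_mod_cast h1) (by exact_mod_cast h2))
  have h : (piOmega N k : ℝ) * log N - ∑ n ∈ (Icc 1 N).filter (fun n => bigOmega n = k), log n =
      ∑ n ∈ (Icc 1 N).filter (fun n => bigOmega n = k), (log N - log n) := by
    rw [Finset.sum_sub_distrib, Finset.sum_const, nsmul_eq_mul]
    rfl
  rw [h, abs_of_nonneg (Finset.sum_nonneg fun n hn => hnn n (Finset.mem_filter.1 hn).1)]
  exact (Finset.sum_le_sum_of_subset_of_nonneg (Finset.filter_subset _ _)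
    fun n hn _ => hnn n hn).trans (sum_log_div_le N)

theorem abs_sum_theta_sub_le {ε B : ℝ} (hB : 0 ≤ B)
    (h : ∀ x, 0 ≤ x → |Chebyshev.theta x - x| ≤ ε * x + B) (N k : ℕ) :
    |∑ m ∈ (Icc 1 N).filter (fun m => bigOmega m = k), Chebyshev.theta ((N : ℝ) / m) -
      N * omegaHarmonic N k| ≤ ε * (N * omegaHarmonic N k) + B * N := by
  rw [omegaHarmonic, Finset.mul_sum, ← Finset.sum_sub_distrib, Finset.mul_sum]
  refine (Finset.abs_sum_le_sum_abs _ _).trans ?_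
  calc _ ≤ ∑ m ∈ (Icc 1 N).filter (fun m => bigOmega m = k), (ε * (N * (m : ℝ)⁻¹) + B) :=
        Finset.sum_le_sum fun m _ => h _ (by positivity)
    _ ≤ _ := by
      rw [Finset.sum_add_distrib, Finset.sum_const, nsmul_eq_mul, mul_comm _ B]
      gcongr
      exact (Finset.card_filter_le _ _).trans (by simp)

theorem exists_abs_piOmega_mul_log_sub_le {ε : ℝ} (hε : 0 < ε) :
    ∃ A, 0 ≤ A ∧ ∀ N k : ℕ, |(piOmega N (k + 1) : ℝ) * log N - N * omegaHarmonic N k| ≤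
      ε * (N * omegaHarmonic N k) + A * N := by
  obtain ⟨B, hB, h⟩ := exists_abs_theta_sub_le hε
  have hK : 0 ≤ ∑' n : ℕ, properPowerLog n / n :=
    tsum_nonneg fun n => div_nonneg (properPowerLog_nonneg n) n.cast_nonneg
  refine ⟨1 + ∑' n : ℕ, properPowerLog n / n + B, by positivity, fun N k => ?_⟩
  have h1 := abs_le.1 (abs_piOmega_mul_log_sub_le N (k + 1))
  have h2 := abs_le.1 (abs_sum_theta_sub_le hB h N k)
  have h3 : ∑ n ∈ (Icc 1 N).filter (fun n => bigOmega n = k + 1),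
      (properPowerLog * ArithmeticFunction.zeta) n ≤ (∑' n : ℕ, properPowerLog n / n) * N :=
    (Finset.sum_le_sum_of_subset_of_nonneg (Finset.filter_subset _ _)
      fun n _ _ => properPowerLog_mul_zeta_nonneg n).trans (sum_properPowerLog_mul_zeta_le N)
  have h4 : 0 ≤ ∑ n ∈ (Icc 1 N).filter (fun n => bigOmega n = k + 1),
      (properPowerLog * ArithmeticFunction.zeta) n :=
    Finset.sum_nonneg fun n _ => properPowerLog_mul_zeta_nonneg n
  rw [sum_log_eq] at h1
  have h5 := mul_nonneg hK (Nat.cast_nonneg (α := ℝ) N)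
  rw [abs_le]
  constructor <;> linarith [h1.1, h1.2, h2.1, h2.2]

theorem eventually_one_le_and_abs_pred_sub_le {ι : Type*} {l : Filter ι} {N k : ι → ℕ} {C : ℝ}
    (hN : Tendsto N l atTop)
    (hk : ∀ᶠ i in l, |(k i : ℝ) - log (log (N i))| ≤ C * sqrt (log (log (N i)))) :
    ∀ᶠ i in l, 1 ≤ k i ∧
      |((k i - 1 : ℕ) : ℝ) - log (log (N i))| ≤ (C + 1) * sqrt (log (log (N i))) := by
  have hl := Real.tendsto_sqrt_atTop.comp (Real.tendsto_log_atTop.comp (tendsto_log_natCast hN))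
  filter_upwards [hk, hl.eventually_ge_atTop 1, hl.eventually_ge_atTop (C + 1)] with i h1 h2 h3
  simp only [Function.comp_apply] at h2 h3
  have h4 : 0 ≤ log (log (N i)) := by
    by_contra! h
    rw [Real.sqrt_eq_zero_of_nonpos h.le] at h2
    linarith
  have h5 := Real.mul_self_sqrt h4
  set s := sqrt (log (log (N i)))
  have h6 := abs_le.1 h1
  have h7 : 1 ≤ k i := by
    by_contra! h
    have : (k i : ℝ) = 0 := by exact_mod_cast (by omega : k i = 0)
    nlinarith [h6.1]
  refine ⟨h7, ?_⟩
  rw [Nat.cast_sub h7, abs_le]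
  constructor <;> push_cast <;> linarith [h6.1, h6.2]

theorem tendsto_piOmega_div {ι : Type*} {l : Filter ι} {N k : ι → ℕ} {C : ℝ}
    (hN : Tendsto N l atTop) (hC : 1 ≤ C)
    (hk : ∀ᶠ i in l, |(k i : ℝ) - log (log (N i))| ≤ C * sqrt (log (log (N i)))) :
    Tendsto (fun i => (piOmega (N i) (k i) : ℝ) / N i / gaussN (N i) (k i)) l (nhds 1) := by
  have hpred := eventually_one_le_and_abs_pred_sub_le hN hk
  have hlog := tendsto_log_natCast hN
  have hpos : ∀ᶠ i in l, 0 < gaussN (N i) (k i) ∧ 0 < gaussN (N i) (k i - 1) := by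
    filter_upwards [(Real.tendsto_log_atTop.comp hlog).eventually_gt_atTop 0] with i hi
    exact ⟨gaussN_pos hi _, gaussN_pos hi _⟩
  have hQ : Tendsto (fun i => omegaHarmonic (N i) (k i - 1) /
      (log (N i) * gaussN (N i) (k i))) l (nhds 1) := by
    have := (tendsto_omegaHarmonic_div hN (by linarith : 1 ≤ C + 1)
      (hpred.mono fun i h => h.2)).mul
      (tendsto_gaussN_pred_div hN (hpred.mono fun i h => h.1) hk)
    rw [mul_one] at this
    refine this.congr' ?_
    filter_upwards [hpos] with i hi
    have := hi.2.ne'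
    field_simp
  have hL := (tendsto_log_mul_gaussN hN hk).inv_tendsto_atTop
  rw [Metric.tendsto_nhds]
  intro δ hδ
  obtain ⟨A, hA, hmain⟩ := exists_abs_piOmega_mul_log_sub_le (by positivity : (0 : ℝ) < δ / 4)
  have hAL := hL.const_mul A
  rw [mul_zero] at hAL
  filter_upwards [hpred, hpos, hlog.eventually_gt_atTop 0, hN.eventually_gt_atTop 0,
    hAL.eventually_lt_const (by positivity : (0 : ℝ) < δ / 4),
    Metric.tendsto_nhds.1 hQ (δ / 4) (by positivity),
    hQ.eventually_lt_const (by norm_num : (1 : ℝ) < 2)] with i h1 h2 h3 h4 h5 h6 h7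
  have h := hmain (N i) (k i - 1)
  rw [Nat.sub_add_cancel h1.1] at h
  have hNi : (0 : ℝ) < N i := by exact_mod_cast h4
  have hg := h2.1
  set g := gaussN (N i) (k i)
  set H := omegaHarmonic (N i) (k i - 1)
  set q := H / (log (N i) * g) with hq
  have hD : 0 < (N i : ℝ) * (log (N i) * g) := by positivity
  have hH : (N i : ℝ) * H = q * (N i * (log (N i) * g)) := by rw [hq]; field_simp
  have hP : (piOmega (N i) (k i) : ℝ) * log (N i) =
      (piOmega (N i) (k i) : ℝ) / N i / g * (N i * (log (N i) * g)) := by field_simp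
  have hR : A * N i = A * (log (N i) * g)⁻¹ * (N i * (log (N i) * g)) := by field_simp
  rw [hH, hP, hR, ← sub_mul, abs_mul, abs_of_pos hD, ← mul_assoc (δ / 4), ← add_mul,
    mul_le_mul_iff_left₀ hD] at h
  simp only [Pi.inv_apply] at h5
  rw [Real.dist_eq] at h6 ⊢
  have := abs_sub_le ((piOmega (N i) (k i) : ℝ) / N i / g) q 1
  nlinarith

/-- **Gaussian approximation of `π_N(k)/N` uniformly on the Hardy–Ramanujan range.** -/
theorem piOmega_gaussian_approx (C : ℝ) (hC : 1 ≤ C) (ε : ℝ) (hε : 0 < ε) :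
    ∃ N₀ : ℕ, ∀ N ≥ N₀, ∀ k : ℕ,
      |(k : ℝ) - Real.log (Real.log N)| ≤ C * Real.sqrt (Real.log (Real.log N)) →
      |(piOmega N k : ℝ) / (N : ℝ) - gaussN N k| ≤ ε * gaussN N k := by
  set S : Set (ℕ × ℕ) :=
    {p | |(p.2 : ℝ) - log (log p.1)| ≤ C * sqrt (log (log p.1))}
  set l : Filter (ℕ × ℕ) := comap Prod.fst atTop ⊓ 𝓟 S
  have hN : Tendsto Prod.fst l atTop := tendsto_comap.mono_left inf_le_left
  have hk : ∀ᶠ p in l, |(p.2 : ℝ) - log (log p.1)| ≤ C * sqrt (log (log p.1)) :=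
    eventually_inf_principal.2 (Eventually.of_forall fun _ h => h)
  have hpos := (Real.tendsto_log_atTop.comp (tendsto_log_natCast hN)).eventually_gt_atTop 0
  have hev : ∀ᶠ p in l, |(piOmega p.1 p.2 : ℝ) / p.1 - gaussN p.1 p.2| ≤ ε * gaussN p.1 p.2 := by
    filter_upwards [Metric.tendsto_nhds.1 (tendsto_piOmega_div hN hC hk) ε hε, hpos] with p h1 h2
    have hg := gaussN_pos h2 p.2
    rw [Real.dist_eq, div_sub_one hg.ne', abs_div, abs_of_pos hg, div_lt_iff₀ hg] at h1
    exact h1.le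
  rw [eventually_inf_principal, eventually_comap, eventually_atTop] at hev
  obtain ⟨N₀, h⟩ := hev
  exact ⟨N₀, fun N hN k hk => h N hN (N, k) rfl hk⟩
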